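/- Let $B$ be the open unit ball in $\mathbb{C}^n$ and $\alpha\in(0,1]$. Suppose $u\in C^2(B)\cap C(\bar B)$ is plurisubharmonic on $B$ and satisfies $\det(u_{i\bar j})=f$ in $B$ and $u=\varphi$ on $\partial B$, where $\varphi\in C^{1,\alpha}(\partial B)$, $f\geq 0$ and $f^{1/n}\in C^{1,\alpha}(\bar B)$. Then for every $t\in(0,1]$ there is a constant $C=C(n,t)$ depending only on $n$ and $t$ such that for every $x\in B$ with $|x|<1-t/2$ and every $h\in(0,t/4)$: $0\leq \fint_{\partial B_h(0)}u(x+y)\,d\sigma_y-u(x)\leq C\,([\varphi]_{1,\alpha;\partial B}+|f^{1/n}|'_{1,\alpha;B})\,h^{1+\alpha}$, where the barred integral denotes the average of $y\mapsto u(x+y)$ over the real sphere $\{y\in\mathbb{C}^n:|y|=h\}$ with respect to surface measure. -/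

import Mathlib

open Metric Set MeasureTheory
open scoped ComplexOrder

/-- The complex Hessian matrix `(u_{i j̄})` of a function `u : ℂⁿ → ℝ`, where
`u_{i j̄} = ∂²u/∂z_i∂z̄_j = (1/4)(u_{xᵢxⱼ} + u_{yᵢyⱼ} + i (u_{xᵢyⱼ} - u_{yᵢxⱼ}))`,
computed via real Fréchet derivatives. -/
noncomputable def cxHessian (n : ℕ) (u : EuclideanSpace ℂ (Fin n) → ℝ)
    (z : EuclideanSpace ℂ (Fin n)) : Matrix (Fin n) (Fin n) ℂ :=
  Matrix.of fun i j =>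
    (1 / 4 : ℂ) *
      (Complex.ofReal
          ((fderiv ℝ (fun w => fderiv ℝ u w (EuclideanSpace.single j (1 : ℂ))) z)
              (EuclideanSpace.single i (1 : ℂ))
            + (fderiv ℝ (fun w => fderiv ℝ u w (EuclideanSpace.single j Complex.I)) z)
              (EuclideanSpace.single i Complex.I))
        + Complex.I *
          Complex.ofReal
            ((fderiv ℝ (fun w => fderiv ℝ u w (EuclideanSpace.single j Complex.I)) z)
                (EuclideanSpace.single i (1 : ℂ))
              - (fderiv ℝ (fun w => fderiv ℝ u w (EuclideanSpace.single j (1 : ℂ))) z)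
                (EuclideanSpace.single i Complex.I)))

/-- The average of `y ↦ u (x + y)` over the real sphere `{y ∈ ℂⁿ : ‖y‖ = h}`,
with respect to the `(2n-1)`-dimensional Hausdorff (surface) measure. -/
noncomputable def sphereAvgC (n : ℕ) (u : EuclideanSpace ℂ (Fin n) → ℝ)
    (x : EuclideanSpace ℂ (Fin n)) (h : ℝ) : ℝ :=
  letI : MeasurableSpace (EuclideanSpace ℂ (Fin n)) := borel _
  haveI : BorelSpace (EuclideanSpace ℂ (Fin n)) := ⟨rfl⟩
  ⨍ y in sphere (0 : EuclideanSpace ℂ (Fin n)) h, u (x + y) ∂(μH[2 * (n : ℝ) - 1])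

section SphereMeasure

variable {E : Type*} [NormedAddCommGroup E] [InnerProductSpace ℝ E] [FiniteDimensional ℝ E]

lemma finrank_orthogonal_unit {v : E} (hv : ‖v‖ = 1) :
    (Module.finrank ℝ (ℝ ∙ v)ᗮ : ℝ) = (Module.finrank ℝ E : ℝ) - 1 := by
  have h0 : v ≠ 0 := by rintro rfl; simp at hv
  have h := (ℝ ∙ v).finrank_add_finrank_orthogonal
  rw [finrank_span_singleton h0] at h
  rw [← h]; push_cast; ring

variable [MeasurableSpace E] [BorelSpace E]

lemma hausdorffMeasure_halfSphere_lt_top {v : E} (hv : ‖v‖ = 1) :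
    μH[(Module.finrank ℝ E : ℝ) - 1] {x ∈ sphere (0 : E) 1 | inner ℝ v x ≤ 0} < ⊤ := by
  rw [← finrank_orthogonal_unit hv]
  let F : (ℝ ∙ v)ᗮ → E := fun w => stereoInvFunAux v (w : E)
  have hF : ContDiff ℝ 1 F := contDiff_stereoInvFunAux.comp (ℝ ∙ v)ᗮ.subtypeL.contDiff
  obtain ⟨K, hK⟩ := hF.contDiffOn.exists_lipschitzOnWith one_ne_zero
    (convex_closedBall (0 : (ℝ ∙ v)ᗮ) 2) (isCompact_closedBall _ _)
  have hsub : {x ∈ sphere (0 : E) 1 | inner ℝ v x ≤ 0} ⊆ F '' closedBall 0 2 := by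
    rintro x ⟨hx, hxv⟩
    have hne : (⟨x, hx⟩ : sphere (0 : E) 1).1 ≠ v := by
      rintro h
      dsimp only at h
      rw [h, real_inner_self_eq_norm_sq, hv] at hxv
      norm_num at hxv
    refine ⟨stereoToFun v x, ?_, ?_⟩
    · rw [mem_closedBall_zero_iff, stereoToFun, norm_smul]
      have hx1 : ‖x‖ = 1 := by simpa using hx
      have h1 : ‖(ℝ ∙ v)ᗮ.orthogonalProjectionOnto x‖ ≤ 1 := by
        calc _ ≤ ‖x‖ := Submodule.norm_orthogonalProjectionOnto_apply_le _ _
          _ = 1 := hx1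
      have h2 : ‖(2 : ℝ) / ((1 : ℝ) - innerSL ℝ v x)‖ ≤ 2 := by
        rw [innerSL_apply_apply, Real.norm_of_nonneg (by apply div_nonneg <;> linarith)]
        rw [div_le_iff₀ (by linarith)]
        linarith
      calc _ ≤ 2 * 1 := mul_le_mul h2 h1 (norm_nonneg _) (by norm_num)
        _ = 2 := by norm_num
    · exact congrArg Subtype.val (stereo_left_inv hv hne)
  refine (measure_mono hsub).trans_lt ((hK.hausdorffMeasure_image_le (by positivity)).trans_lt ?_)
  exact ENNReal.mul_lt_top (ENNReal.rpow_lt_top_of_nonneg (by positivity) ENNReal.coe_ne_top)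
    (isCompact_closedBall _ _).measure_lt_top

lemma hausdorffMeasure_sphere_lt_top [Nontrivial E] {h : ℝ} (hh : 0 < h) :
    μH[(Module.finrank ℝ E : ℝ) - 1] (sphere (0 : E) h) < ⊤ := by
  obtain ⟨v, hv⟩ := exists_norm_eq E zero_le_one
  have hd : 0 ≤ (Module.finrank ℝ E : ℝ) - 1 := by
    rw [← finrank_orthogonal_unit hv]; positivity
  have h1 : μH[(Module.finrank ℝ E : ℝ) - 1] (sphere (0 : E) 1) < ⊤ := by
    have hsub : sphere (0 : E) 1 ⊆ {x ∈ sphere (0 : E) 1 | inner ℝ v x ≤ 0} ∪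
        {x ∈ sphere (0 : E) 1 | inner ℝ (-v) x ≤ 0} := by
      intro x hx
      rcases le_total (inner ℝ v x) 0 with h | h
      · exact Or.inl ⟨hx, h⟩
      · exact Or.inr ⟨hx, by rw [inner_neg_left]; linarith⟩
    exact (measure_mono hsub).trans_lt (measure_union_lt_top
      (hausdorffMeasure_halfSphere_lt_top hv) (hausdorffMeasure_halfSphere_lt_top (by simpa)))
  have hsub : sphere (0 : E) h ⊆ (fun x : E => h • x) '' sphere (0 : E) 1 := by
    intro x hx
    refine ⟨h⁻¹ • x, ?_, by simp [hh.ne']⟩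
    have : ‖x‖ = h := by simpa using hx
    simp [norm_smul, this, abs_of_pos hh, hh.ne']
  have hL : LipschitzOnWith ‖h‖₊ (fun x : E => h • x) (sphere (0 : E) 1) :=
    (lipschitzWith_smul h).lipschitzOnWith
  refine (measure_mono hsub).trans_lt ((hL.hausdorffMeasure_image_le hd).trans_lt ?_)
  exact ENNReal.mul_lt_top (ENNReal.rpow_lt_top_of_nonneg hd ENNReal.coe_ne_top) h1

lemma hausdorffMeasure_sphere_pos [Nontrivial E] {h : ℝ} (hh : 0 < h) :
    0 < μH[(Module.finrank ℝ E : ℝ) - 1] (sphere (0 : E) h) := by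
  obtain ⟨v, hv⟩ := exists_norm_eq E zero_le_one
  rw [← finrank_orthogonal_unit hv]
  let P : E → (ℝ ∙ v)ᗮ := (ℝ ∙ v)ᗮ.orthogonalProjectionOnto
  have hP : LipschitzWith 1 P := by
    refine LipschitzWith.of_dist_le_mul fun x y => ?_
    rw [dist_eq_norm, dist_eq_norm, NNReal.coe_one, one_mul]
    have : P x - P y = (ℝ ∙ v)ᗮ.orthogonalProjectionOnto (x - y) := (map_sub _ _ _).symm
    rw [this]
    exact Submodule.norm_orthogonalProjectionOnto_apply_le _ _
  have hsub : ball (0 : (ℝ ∙ v)ᗮ) h ⊆ P '' sphere (0 : E) h := by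
    intro w hw
    have hw' : ‖w‖ < h := by simpa using hw
    refine ⟨(w : E) + Real.sqrt (h ^ 2 - ‖w‖ ^ 2) • v, ?_, ?_⟩
    · have ho : inner ℝ (w : E) (Real.sqrt (h ^ 2 - ‖w‖ ^ 2) • v) = 0 := by
        rw [inner_smul_right, Submodule.mem_orthogonal_singleton_iff_inner_left.1 w.2, mul_zero]
      have h2 := norm_add_sq_eq_norm_sq_add_norm_sq_real ho
      rw [norm_smul, hv, mul_one, Real.norm_of_nonneg (Real.sqrt_nonneg _),
        Real.mul_self_sqrt (by nlinarith [norm_nonneg w])] at h2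
      rw [mem_sphere_zero_iff_norm]
      have h3 : ‖(w : E) + Real.sqrt (h ^ 2 - ‖w‖ ^ 2) • v‖ ^ 2 = h ^ 2 := by
        rw [sq, h2, Submodule.coe_norm]; ring
      exact (sq_eq_sq₀ (norm_nonneg _) hh.le).1 h3
    · change (ℝ ∙ v)ᗮ.orthogonalProjectionOnto _ = w
      rw [map_add, map_smul]
      have hv0 : (ℝ ∙ v)ᗮ.orthogonalProjectionOnto v = 0 :=
        Submodule.orthogonalProjectionOnto_orthogonal_apply_eq_zero (Submodule.mem_span_singleton_self v)
      rw [hv0, smul_zero, add_zero]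
      exact Submodule.orthogonalProjectionOnto_mem_subspace_eq_self w
  have h1 := (hP.lipschitzOnWith (s := sphere (0 : E) h)).hausdorffMeasure_image_le
    (d := (Module.finrank ℝ (ℝ ∙ v)ᗮ : ℝ)) (by positivity)
  rw [ENNReal.coe_one, ENNReal.one_rpow, one_mul] at h1
  exact ((isOpen_ball.measure_pos _ ⟨0, by simpa⟩).trans_le (measure_mono hsub)).trans_le h1

end SphereMeasure

section MatrixDeterminant

open Matrix
open scoped MatrixOrder Matrix.Norms.L2Operator

variable {n : ℕ}

lemma det_re_rpow_le_trace (hn : 0 < n) {A : Matrix (Fin n) (Fin n) ℂ} (hA : A.PosSemidef) :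
    (n : ℝ) * A.det.re ^ ((n : ℝ)⁻¹) ≤ A.trace.re := by
  have hn' : (0 : ℝ) < n := by exact_mod_cast hn
  have hd : A.det.re = ∏ i, hA.1.eigenvalues i := by
    rw [hA.1.det_eq_prod_eigenvalues]
    exact_mod_cast Complex.ofReal_re _
  have ht : A.trace.re = ∑ i, hA.1.eigenvalues i := by
    rw [hA.1.trace_eq_sum_eigenvalues]
    exact_mod_cast Complex.ofReal_re _
  have h0 : ∀ i ∈ Finset.univ, 0 ≤ hA.1.eigenvalues i := fun i _ => hA.eigenvalues_nonneg i
  have h := Real.geom_mean_le_arith_mean_weighted Finset.univ (fun _ => (n : ℝ)⁻¹)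
    hA.1.eigenvalues (fun _ _ => by positivity) (by simp [hn'.ne']) h0
  rw [Real.finsetProd_rpow _ _ h0, ← hd, ← Finset.mul_sum, ← ht] at h
  calc (n : ℝ) * A.det.re ^ ((n : ℝ)⁻¹) ≤ n * ((n : ℝ)⁻¹ * A.trace.re) := by gcongr
    _ = A.trace.re := by field_simp

/-- A Minkowski-type determinant inequality. -/
lemma half_det_rpow_add_le (hn : 0 < n) {A₀ A₁ A₂ : Matrix (Fin n) (Fin n) ℂ}
    (h1 : A₁.PosSemidef) (h2 : A₂.PosSemidef) {c : ℝ} (hc : 0 < c)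
    (h : (A₀ - ((1 / 2 : ℂ) • A₁ + (1 / 2 : ℂ) • A₂ + (c : ℂ) • 1)).PosSemidef) :
    A₁.det.re ^ ((n : ℝ)⁻¹) / 2 + A₂.det.re ^ ((n : ℝ)⁻¹) / 2 + c
      ≤ A₀.det.re ^ ((n : ℝ)⁻¹) := by
  have hn' : (0 : ℝ) < n := by exact_mod_cast hn
  have hp0 : A₀.PosDef := by
    have e : A₀ = (c : ℂ) • 1 +
        ((A₀ - ((1 / 2 : ℂ) • A₁ + (1 / 2 : ℂ) • A₂ + (c : ℂ) • 1)) +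
        ((1 / 2 : ℂ) • A₁ + (1 / 2 : ℂ) • A₂)) := by abel
    rw [e]
    refine PosDef.add_posSemidef (PosDef.one.smul (by exact_mod_cast hc)) (h.add ?_)
    have half : (0 : ℂ) ≤ 1 / 2 := by
      rw [Complex.nonneg_iff]; norm_num
    exact (h1.smul half).add (h2.smul half)
  obtain ⟨B, hB⟩ := 
    CStarAlgebra.nonneg_iff_eq_star_mul_self.1 hp0.inv.posSemidef.nonneg
  have hdet0 : 0 < A₀.det := hp0.det_pos
  have hu : IsUnit A₀.det := hdet0.ne'.isUnit
  rw [star_eq_conjTranspose] at hB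
  set d := A₀.det.re with hd
  have hd0 : 0 < d := (Complex.pos_iff.1 hdet0).1
  have hdd : A₀.det = (d : ℂ) := Complex.ext rfl (by simpa using (Complex.pos_iff.1 hdet0).2.symm)
  have hBB : B.det * star B.det = ((d⁻¹ : ℝ) : ℂ) := by
    rw [← det_conjTranspose, mul_comm, ← det_mul, ← hB, det_nonsing_inv, Ring.inverse_eq_inv', hdd,
      Complex.ofReal_inv]
  have key : ∀ A : Matrix (Fin n) (Fin n) ℂ, A.PosSemidef →
      (n : ℝ) * (A.det.re ^ ((n : ℝ)⁻¹) * (d⁻¹) ^ ((n : ℝ)⁻¹)) ≤ (B * A * Bᴴ).trace.re := by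
    intro A hA
    have hle := det_re_rpow_le_trace hn (hA.mul_mul_conjTranspose_same B)
    have e : (B * A * Bᴴ).det.re = A.det.re * d⁻¹ := by
      rw [det_mul, det_mul, det_conjTranspose, mul_right_comm, hBB, Complex.re_ofReal_mul, mul_comm]
    rwa [e, Real.mul_rpow (Complex.nonneg_iff.1 hA.det_nonneg).1 (by positivity)] at hle
  have k1 := key A₁ h1
  have k2 := key A₂ h2
  have k3 := key 1 PosSemidef.one
  have k0 : (B * A₀ * Bᴴ).trace.re = n := by
    rw [mul_assoc, trace_mul_comm, mul_assoc, ← hB, mul_nonsing_inv _ hu]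
    simp
  have k4 : 0 ≤ (B * (A₀ - ((1 / 2 : ℂ) • A₁ + (1 / 2 : ℂ) • A₂ + (c : ℂ) • 1)) * Bᴴ).trace.re :=
    (Complex.nonneg_iff.1 (h.mul_mul_conjTranspose_same B).trace_nonneg).1
  have e4 : (B * (A₀ - ((1 / 2 : ℂ) • A₁ + (1 / 2 : ℂ) • A₂ + (c : ℂ) • 1)) * Bᴴ).trace.re =
      (B * A₀ * Bᴴ).trace.re - ((B * A₁ * Bᴴ).trace.re / 2 + (B * A₂ * Bᴴ).trace.re / 2
        + c * (B * 1 * Bᴴ).trace.re) := by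
    have hh : (1 / 2 : ℂ) = ((1 / 2 : ℝ) : ℂ) := by norm_num
    rw [hh]
    simp only [mul_sub, sub_mul, mul_add, add_mul, trace_sub, trace_add, Matrix.mul_smul,
      Matrix.smul_mul, trace_smul, smul_eq_mul, Complex.sub_re, Complex.add_re,
      Complex.re_ofReal_mul]
    ring
  rw [e4, k0] at k4
  simp only [det_one, Complex.one_re, Real.one_rpow, one_mul] at k3
  have hdp : 0 < d ^ ((n : ℝ)⁻¹) := Real.rpow_pos_of_pos hd0 _
  rw [Real.inv_rpow hd0.le] at k1 k2 k3
  set D := d ^ ((n : ℝ)⁻¹) with hD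
  have fin : (n : ℝ) * ((A₁.det.re ^ ((n : ℝ)⁻¹) / 2 + A₂.det.re ^ ((n : ℝ)⁻¹) / 2 + c) * D⁻¹)
      ≤ n * 1 := by
    have := mul_le_mul_of_nonneg_left k3 hc.le
    nlinarith
  have := le_of_mul_le_mul_left fin hn'
  rwa [← div_eq_mul_inv, div_le_one hdp] at this

end MatrixDeterminant

section SecondDerivative

open Filter Topology

variable {E : Type*} [NormedAddCommGroup E] [NormedSpace ℝ E]

lemma ContDiffAt.hasFDerivAt_fderiv {G : Type*} [NormedAddCommGroup G] [NormedSpace ℝ G]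
    {f : E → G} {z : E} (hf : ContDiffAt ℝ 2 f z) :
    HasFDerivAt (fderiv ℝ f) (fderiv ℝ (fderiv ℝ f) z) z :=
  ((hf.fderiv_right (m := 1) (by norm_num)).differentiableAt one_ne_zero).hasFDerivAt

lemma ContDiffAt.eventually_hasFDerivAt {G : Type*} [NormedAddCommGroup G] [NormedSpace ℝ G]
    {f : E → G} {z : E} (hf : ContDiffAt ℝ 2 f z) :
    ∀ᶠ y in 𝓝 z, HasFDerivAt f (fderiv ℝ f y) y := by
  filter_upwards [hf.eventually (by simp)] with y hy
  exact (hy.differentiableAt two_ne_zero).hasFDerivAt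

lemma IsLocalMax.fderiv_fderiv_nonpos {W : E → ℝ} {z : E} (hmax : IsLocalMax W z)
    (hW : ContDiffAt ℝ 2 W z) (v : E) : fderiv ℝ (fderiv ℝ W) z v v ≤ 0 := by
  by_contra! hpos
  set p : ℝ → E := fun t => z + t • v with hp
  have hp0 : p 0 = z := by simp [hp]
  have hpd : ∀ t, HasDerivAt p v t := fun t => by
    simpa only [one_smul] using ((hasDerivAt_id' t).smul_const v).const_add z
  have hpc : Tendsto p (𝓝 0) (𝓝 z) := hp0 ▸ (hpd 0).continuousAt
  have h1 : ∀ᶠ t in 𝓝 (0 : ℝ), deriv (W ∘ p) t = fderiv ℝ W (p t) v := by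
    filter_upwards [hpc.eventually hW.eventually_hasFDerivAt] with t ht
    exact (ht.comp_hasDerivAt t (hpd t)).deriv
  have h2 : deriv (deriv (W ∘ p)) 0 = fderiv ℝ (fderiv ℝ W) z v v := by
    rw [Filter.EventuallyEq.deriv_eq h1]
    have hd : HasFDerivAt (fderiv ℝ W) (fderiv ℝ (fderiv ℝ W) z) (p 0) :=
      hp0.symm ▸ hW.hasFDerivAt_fderiv
    have := (hd.comp_hasDerivAt 0 (hpd 0)).clm_apply (hasDerivAt_const (0 : ℝ) v)
    simpa using this.deriv
  have hmaxp : IsLocalMax (W ∘ p) 0 := by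
    filter_upwards [hpc.eventually hmax] with t ht
    simpa [hp0] using ht
  have hcont : ContinuousAt (W ∘ p) 0 :=
    ContinuousAt.comp (hp0.symm ▸ hW.continuousAt) (hpd 0).continuousAt
  have hmin : IsLocalMin (W ∘ p) 0 :=
    isLocalMin_of_deriv_deriv_pos (by rw [h2]; exact hpos) hmaxp.deriv_eq_zero hcont
  have hconst : (W ∘ p) =ᶠ[𝓝 0] fun _ => (W ∘ p) 0 := by
    filter_upwards [hmaxp, hmin] with t h1 h2 using le_antisymm h1 h2
  have h3 : deriv (deriv (W ∘ p)) 0 = 0 := by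
    rw [hconst.deriv.deriv_eq]; simp
  rw [h2] at h3
  exact hpos.ne' h3

/-- A weak maximum principle: a function with a direction of strict convexity at each point
is controlled by its boundary values. -/
lemma le_of_exists_fderiv_fderiv_pos [ProperSpace E] [Nontrivial E] {W : E → ℝ} {M : ℝ}
    (hc : ContinuousOn W (closedBall 0 1)) (hd : ∀ z ∈ ball (0 : E) 1, ContDiffAt ℝ 2 W z)
    (hb : ∀ z ∈ sphere (0 : E) 1, W z ≤ M)
    (hpos : ∀ z ∈ ball (0 : E) 1, ∃ v, 0 < fderiv ℝ (fderiv ℝ W) z v v) : W 0 ≤ M := by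
  obtain ⟨z, hz, hmax⟩ := (isCompact_closedBall (0 : E) 1).exists_isMaxOn ⟨0, by simp⟩ hc
  rcases (mem_closedBall.1 hz).lt_or_eq with h | h
  · obtain ⟨v, hv⟩ := hpos z h
    have hloc : IsLocalMax W z := by
      filter_upwards [isOpen_ball.mem_nhds (mem_ball.2 h)] with y hy
      exact hmax (ball_subset_closedBall hy)
    exact absurd (hloc.fderiv_fderiv_nonpos (hd z h) v) hv.not_ge
  · exact (hmax (by simp : (0 : E) ∈ closedBall 0 1)).trans (hb z h)

lemma fderiv_fderiv_add {u v : E → ℝ} {z : E} (hu : ContDiffAt ℝ 2 u z)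
    (hv : ContDiffAt ℝ 2 v z) : fderiv ℝ (fderiv ℝ (fun w => u w + v w)) z =
      fderiv ℝ (fderiv ℝ u) z + fderiv ℝ (fderiv ℝ v) z := by
  have h : fderiv ℝ (fun w => u w + v w) =ᶠ[𝓝 z] fun w => fderiv ℝ u w + fderiv ℝ v w := by
    filter_upwards [hu.eventually_hasFDerivAt, hv.eventually_hasFDerivAt] with w h1 h2
    exact (h1.add h2).fderiv
  rw [h.fderiv_eq]
  exact (hu.hasFDerivAt_fderiv.add hv.hasFDerivAt_fderiv).fderiv

lemma fderiv_fderiv_const_mul {u : E → ℝ} {z : E} (hu : ContDiffAt ℝ 2 u z) (c : ℝ) :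
    fderiv ℝ (fderiv ℝ (fun w => c * u w)) z = c • fderiv ℝ (fderiv ℝ u) z := by
  have h : fderiv ℝ (fun w => c * u w) =ᶠ[𝓝 z] fun w => c • fderiv ℝ u w := by
    filter_upwards [hu.eventually_hasFDerivAt] with w h1
    exact (h1.const_mul c).fderiv
  rw [h.fderiv_eq]
  exact (hu.hasFDerivAt_fderiv.const_smul c).fderiv

variable [NormedSpace ℂ E]

/-- Four times the Levi form of `u` at `z` in the direction `v`. -/
noncomputable def leviForm (u : E → ℝ) (z v : E) : ℝ :=
  fderiv ℝ (fderiv ℝ u) z v v + fderiv ℝ (fderiv ℝ u) z (Complex.I • v) (Complex.I • v)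

lemma exists_fderiv_fderiv_pos_of_leviForm_pos {u : E → ℝ} {z v : E} (h : 0 < leviForm u z v) :
    ∃ w, 0 < fderiv ℝ (fderiv ℝ u) z w w := by
  by_contra! hle
  exact (add_nonpos (hle v) (hle (Complex.I • v))).not_gt h

lemma leviForm_add {u v : E → ℝ} {z : E} (hu : ContDiffAt ℝ 2 u z) (hv : ContDiffAt ℝ 2 v z)
    (w : E) : leviForm (fun y => u y + v y) z w = leviForm u z w + leviForm v z w := by
  simp only [leviForm, fderiv_fderiv_add hu hv, add_apply]
  ring

lemma leviForm_const_mul {u : E → ℝ} {z : E} (hu : ContDiffAt ℝ 2 u z) (c : ℝ) (w : E) :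
    leviForm (fun y => c * u y) z w = c * leviForm u z w := by
  simp only [leviForm, fderiv_fderiv_const_mul hu, smul_apply, smul_eq_mul]
  ring

lemma leviForm_clm (l : E →L[ℝ] ℝ) (z w : E) : leviForm l z w = 0 := by
  have h : fderiv ℝ l = fun _ => l := by ext1 x; exact l.fderiv
  simp [leviForm, h]

lemma leviForm_norm_sq {E : Type*} [NormedAddCommGroup E] [InnerProductSpace ℝ E]
    [NormedSpace ℂ E] (z v : E) : leviForm (fun y : E => ‖y‖ ^ 2) z v = 4 * ‖v‖ ^ 2 := by
  have h : fderiv ℝ (fun y : E => ‖y‖ ^ 2) = fun y => ((2 : ℝ) • innerSL ℝ) y := by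
    ext1 y
    rw [fderiv_norm_sq]
    ext w
    simp
  rw [leviForm, h, ContinuousLinearMap.fderiv]
  change 2 * inner ℝ v v + 2 * inner ℝ (Complex.I • v) (Complex.I • v) = _
  rw [real_inner_self_eq_norm_sq, real_inner_self_eq_norm_sq, norm_smul, Complex.norm_I]
  ring

/-- The Levi form is invariant under holomorphic maps. -/
lemma leviForm_comp [IsScalarTower ℝ ℂ E] {F : Type*} [NormedAddCommGroup F] [NormedSpace ℝ F]
    [NormedSpace ℂ F] [IsScalarTower ℝ ℂ F] {u : E → ℝ} {T : F → E} {z : F}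
    (hu : ContDiffAt ℝ 2 u (T z)) (hT : ContDiffAt ℂ 2 T z) (v : F) :
    leviForm (fun w => u (T w)) z v = leviForm u (T z) (fderiv ℂ T z v) := by
  have hTR : ContDiffAt ℝ 2 T z := hT.restrict_scalars ℝ
  have hTe : ∀ᶠ y in 𝓝 z, fderiv ℝ T y = (fderiv ℂ T y).restrictScalars ℝ := by
    filter_upwards [hT.eventually (by simp)] with y hy
    exact (hy.differentiableAt two_ne_zero).fderiv_restrictScalars ℝ
  have hI : ∀ w, fderiv ℝ T z (Complex.I • w) = Complex.I • fderiv ℝ T z w := by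
    intro w; rw [hTe.self_of_nhds]; simp
  have h2I : ∀ a w, fderiv ℝ (fderiv ℝ T) z a (Complex.I • w) =
      Complex.I • fderiv ℝ (fderiv ℝ T) z a w := by
    intro a w
    have hd := hTR.hasFDerivAt_fderiv
    have d1 := hd.clm_apply (hasFDerivAt_const (Complex.I • w) z)
    have d2 := (hd.clm_apply (hasFDerivAt_const w z)).const_smul Complex.I
    have he : (fun y => fderiv ℝ T y (Complex.I • w)) =ᶠ[𝓝 z]
        fun y => Complex.I • fderiv ℝ T y w := by
      filter_upwards [hTe] with y hy
      rw [hy]; simp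
    have := congrArg (fun L => L a) (d1.unique (d2.congr_of_eventuallyEq he))
    simpa using this
  have hsymm : ∀ a b, fderiv ℝ (fderiv ℝ T) z a b = fderiv ℝ (fderiv ℝ T) z b a := fun a b =>
    (hTR.isSymmSndFDerivAt (by simp)) a b
  have hII : fderiv ℝ (fderiv ℝ T) z (Complex.I • v) (Complex.I • v) =
      - fderiv ℝ (fderiv ℝ T) z v v := by
    rw [h2I, hsymm, h2I, smul_smul, Complex.I_mul_I, neg_one_smul]
  have hcomp : fderiv ℝ (fun w => u (T w)) =ᶠ[𝓝 z]
      fun w => (fderiv ℝ u (T w)).comp (fderiv ℝ T w) := by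
    filter_upwards [hTR.eventually_hasFDerivAt,
      hTR.continuousAt.eventually hu.eventually_hasFDerivAt] with w h1 h2
    exact (h2.comp w h1).fderiv
  have hder : ∀ a b, fderiv ℝ (fderiv ℝ (fun w => u (T w))) z a b =
      fderiv ℝ (fderiv ℝ u) (T z) (fderiv ℝ T z a) (fderiv ℝ T z b) +
        fderiv ℝ u (T z) (fderiv ℝ (fderiv ℝ T) z a b) := by
    intro a b
    rw [hcomp.fderiv_eq]
    have h1 : HasFDerivAt (fun w => fderiv ℝ u (T w)) _ z :=
      hu.hasFDerivAt_fderiv.comp z (hTR.differentiableAt two_ne_zero).hasFDerivAt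
    rw [(h1.clm_comp hTR.hasFDerivAt_fderiv).fderiv]
    simp [add_comm]
  rw [leviForm, leviForm, hder, hder, hII, hI, hTe.self_of_nhds, map_neg]
  simp only [ContinuousLinearMap.coe_restrictScalars']
  ring

end SecondDerivative

section ComplexHessian

open Matrix

variable {n : ℕ}

lemma EuclideanSpace.eq_sum_re_im (v : EuclideanSpace ℂ (Fin n)) :
    v = ∑ j, ((v j).re • EuclideanSpace.single j (1 : ℂ) +
      (v j).im • EuclideanSpace.single j Complex.I) := by
  ext k
  simp [Finset.sum_apply, Finset.sum_add_distrib, Pi.single_apply]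

lemma re_dotProduct_cxHessian_mulVec {u : EuclideanSpace ℂ (Fin n) → ℝ}
    {z : EuclideanSpace ℂ (Fin n)} (hu : ContDiffAt ℝ 2 u z) (v : EuclideanSpace ℂ (Fin n)) :
    (v.ofLp ⬝ᵥ cxHessian n u z *ᵥ star v.ofLp).re = leviForm u z v / 4 := by
  set D := fderiv ℝ (fderiv ℝ u) z with hD
  have hf : ∀ a b, fderiv ℝ (fun w => fderiv ℝ u w b) z a = D a b := by
    intro a b
    rw [(hu.hasFDerivAt_fderiv.clm_apply (hasFDerivAt_const b z)).fderiv]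
    simp [hD]
  have hIv : Complex.I • v = ∑ j, ((v j).re • EuclideanSpace.single j Complex.I +
      (-(v j).im) • EuclideanSpace.single j (1 : ℂ)) := by
    rw [EuclideanSpace.eq_sum_re_im (Complex.I • v)]
    refine Finset.sum_congr rfl fun j _ => ?_
    simp [add_comm]
  have hv1 := congrArg₂ (fun a b => D a b) (EuclideanSpace.eq_sum_re_im v)
    (EuclideanSpace.eq_sum_re_im v)
  have hv2 := congrArg₂ (fun a b => D a b) hIv hIv
  dsimp only at hv1 hv2
  rw [leviForm, ← hD, hv1, hv2]
  simp only [map_sum, _root_.sum_apply, map_add, _root_.add_apply, map_smul, _root_.smul_apply,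
    smul_eq_mul, dotProduct, mulVec, cxHessian, of_apply, hf, Complex.re_sum, Finset.mul_sum,
    ← Finset.sum_add_distrib, Finset.sum_div]
  rw [Finset.sum_comm]
  refine Finset.sum_congr rfl fun i _ => Finset.sum_congr rfl fun j _ => ?_
  simp
  ring

lemma posSemidef_of_re_nonneg {A : Matrix (Fin n) (Fin n) ℂ} (hA : A.IsHermitian)
    (h : ∀ x : Fin n → ℂ, 0 ≤ (star x ⬝ᵥ A *ᵥ x).re) : A.PosSemidef := by
  refine PosSemidef.of_dotProduct_mulVec_nonneg hA fun x => ?_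
  rw [Complex.nonneg_iff]
  exact ⟨h x, (hA.im_star_dotProduct_mulVec_self x).symm⟩

end ComplexHessian

section BallAutomorphism

variable {n : ℕ}

/-- The holomorphic automorphism of the unit ball of `ℂⁿ` sending `0` to `a`. -/
noncomputable def ballAut (a w : EuclideanSpace ℂ (Fin n)) : EuclideanSpace ℂ (Fin n) :=
  (1 + inner ℂ a w)⁻¹ •
    (a + (√(1 - ‖a‖ ^ 2) : ℂ) • w + (inner ℂ a w / (1 + √(1 - ‖a‖ ^ 2) : ℂ)) • a)

/-- The `n`-th root of the real Jacobian determinant of `ballAut a`. -/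
noncomputable def ballAutJac (n : ℕ) (a w : EuclideanSpace ℂ (Fin n)) : ℝ :=
  ((1 - ‖a‖ ^ 2) / ‖1 + inner ℂ a w‖ ^ 2) ^ (((n : ℝ) + 1) * (n : ℝ)⁻¹)

lemma one_add_inner_ne_zero {a w : EuclideanSpace ℂ (Fin n)} (ha : ‖a‖ < 1) (hw : ‖w‖ ≤ 1) :
    1 + inner ℂ a w ≠ 0 := by
  intro h
  have h1 : inner ℂ a w = -1 := by linear_combination h
  have h2 := norm_inner_le_norm (𝕜 := ℂ) a w
  rw [h1, norm_neg, norm_one] at h2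
  nlinarith [norm_nonneg a, norm_nonneg w]

lemma ballAut_zero (a : EuclideanSpace ℂ (Fin n)) : ballAut a 0 = a := by
  simp [ballAut]

lemma norm_ballAut_sq {a w : EuclideanSpace ℂ (Fin n)} (ha : ‖a‖ < 1) (hw : ‖w‖ ≤ 1) :
    ‖ballAut a w‖ ^ 2 = 1 - (1 - ‖a‖ ^ 2) * (1 - ‖w‖ ^ 2) / ‖1 + inner ℂ a w‖ ^ 2 := by
  have hs2 : 0 < 1 - ‖a‖ ^ 2 := by nlinarith [norm_nonneg a]
  set s := √(1 - ‖a‖ ^ 2) with hs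
  have hs0 : 0 ≤ s := Real.sqrt_nonneg _
  have hss : s ^ 2 = 1 - ‖a‖ ^ 2 := Real.sq_sqrt hs2.le
  have hne := one_add_inner_ne_zero ha hw
  have hpos : 0 < ‖1 + inner ℂ a w‖ ^ 2 := by positivity
  set W := inner ℂ a w with hW
  have hsC : (1 + s : ℂ) ≠ 0 := by
    have : (1 + s : ℝ) ≠ 0 := by positivity
    exact_mod_cast this
  have e : a + (s : ℂ) • w + (W / (1 + s : ℂ)) • a =
      (1 + W / (1 + s : ℂ)) • a + (s : ℂ) • w := by
    rw [add_smul, one_smul]; abel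
  have hin : RCLike.re (inner ℂ ((1 + W / (1 + s : ℂ)) • a) ((s : ℂ) • w)) =
      s * (W.re + ‖W‖ ^ 2 / (1 + s)) := by
    have : inner ℂ ((1 + W / (1 + s : ℂ)) • a) ((s : ℂ) • w) =
        ((s : ℝ) : ℂ) * (W + ((‖W‖ ^ 2 / (1 + s) : ℝ) : ℂ)) := by
      rw [inner_smul_left, inner_smul_right, ← hW]
      have hWW : (starRingEnd ℂ) W * W = ((‖W‖ ^ 2 : ℝ) : ℂ) := by
        rw [← Complex.normSq_eq_norm_sq, ← Complex.normSq_eq_conj_mul_self]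
      push_cast at hWW ⊢
      rw [map_add, map_div₀, map_one, map_add, map_one, Complex.conj_ofReal, ← hWW]
      field_simp
    rw [this]
    simp only [RCLike.re_to_complex, Complex.re_ofReal_mul, Complex.add_re, Complex.ofReal_re]
  have hn1 : ‖1 + W / (1 + s : ℂ)‖ ^ 2 = 1 + 2 * W.re / (1 + s) + ‖W‖ ^ 2 / (1 + s) ^ 2 := by
    have : W / (1 + s : ℂ) = ((1 / (1 + s) : ℝ) : ℂ) * W := by push_cast; field_simp
    rw [this, ← Complex.normSq_eq_norm_sq, ← Complex.normSq_eq_norm_sq, Complex.normSq_apply,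
      Complex.normSq_apply]
    simp only [Complex.add_re, Complex.add_im, Complex.one_re, Complex.one_im,
      Complex.re_ofReal_mul, Complex.im_ofReal_mul]
    have : 1 + s ≠ 0 := by positivity
    field_simp
    ring
  have hn2 : ‖1 + W‖ ^ 2 = 1 + 2 * W.re + ‖W‖ ^ 2 := by
    rw [← Complex.normSq_eq_norm_sq, ← Complex.normSq_eq_norm_sq, Complex.normSq_apply,
      Complex.normSq_apply]
    simp only [Complex.add_re, Complex.add_im, Complex.one_re, Complex.one_im]
    ring
  have ha2 : ‖a‖ ^ 2 = 1 - s ^ 2 := by rw [hss]; ring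
  rw [ballAut, ← hs, ← hW, e, norm_smul, mul_pow, norm_add_sq (𝕜 := ℂ), hin, norm_smul, norm_smul,
    mul_pow, mul_pow, hn1, norm_inv, inv_pow, ha2, Complex.norm_real, Real.norm_of_nonneg hs0]
  rw [hn2] at hpos ⊢
  have : 1 + s ≠ 0 := by positivity
  field_simp
  ring

lemma norm_ballAut_lt_one {a w : EuclideanSpace ℂ (Fin n)} (ha : ‖a‖ < 1) (hw : ‖w‖ < 1) :
    ‖ballAut a w‖ < 1 := by
  have h := norm_ballAut_sq ha hw.le
  have hne := one_add_inner_ne_zero ha hw.le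
  have h1 : 0 < 1 - ‖a‖ ^ 2 := by nlinarith [norm_nonneg a]
  have h2 : 0 < 1 - ‖w‖ ^ 2 := by nlinarith [norm_nonneg w]
  have : 0 < (1 - ‖a‖ ^ 2) * (1 - ‖w‖ ^ 2) / ‖1 + inner ℂ a w‖ ^ 2 := by positivity
  nlinarith [norm_nonneg (ballAut a w)]

lemma norm_ballAut_eq_one {a w : EuclideanSpace ℂ (Fin n)} (ha : ‖a‖ < 1) (hw : ‖w‖ = 1) :
    ‖ballAut a w‖ = 1 := by
  have h := norm_ballAut_sq ha hw.le
  rw [hw] at h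
  have h' : ‖ballAut a w‖ ^ 2 = 1 := by rw [h]; simp
  nlinarith [norm_nonneg (ballAut a w)]

lemma norm_ballAut_le_one {a w : EuclideanSpace ℂ (Fin n)} (ha : ‖a‖ < 1) (hw : ‖w‖ ≤ 1) :
    ‖ballAut a w‖ ≤ 1 := by
  rcases hw.lt_or_eq with h | h
  · exact (norm_ballAut_lt_one ha h).le
  · exact (norm_ballAut_eq_one ha h).le

/-- The domain on which `ballAut` and `ballAutJac` are smooth. -/
def ballAutDomain (n : ℕ) : Set (EuclideanSpace ℂ (Fin n) × EuclideanSpace ℂ (Fin n)) :=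
  {p | ‖p.1‖ < 1 ∧ 1 + inner ℂ p.1 p.2 ≠ 0}

lemma isOpen_ballAutDomain : IsOpen (ballAutDomain n) :=
  (isOpen_lt continuous_fst.norm continuous_const).inter
    (isOpen_ne_fun (continuous_const.add (continuous_fst.inner continuous_snd)) continuous_const)

lemma contDiffOn_one_add_inner {s : Set (EuclideanSpace ℂ (Fin n) × EuclideanSpace ℂ (Fin n))} :
    ContDiffOn ℝ 2 (fun p : EuclideanSpace ℂ (Fin n) × EuclideanSpace ℂ (Fin n) =>
      inner ℂ p.1 p.2) s :=
  (contDiff_fst.inner ℂ contDiff_snd).contDiffOn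

lemma contDiffOn_one_sub_norm_sq {s : Set (EuclideanSpace ℂ (Fin n) × EuclideanSpace ℂ (Fin n))} :
    ContDiffOn ℝ 2 (fun p : EuclideanSpace ℂ (Fin n) × EuclideanSpace ℂ (Fin n) =>
      1 - ‖p.1‖ ^ 2) s :=
  (contDiff_const.sub (contDiff_fst.norm_sq ℝ)).contDiffOn

lemma contDiffOn_ballAut :
    ContDiffOn ℝ 2 (fun p : EuclideanSpace ℂ (Fin n) × EuclideanSpace ℂ (Fin n) =>
      ballAut p.1 p.2) (ballAutDomain n) := by
  have hs : ContDiffOn ℝ 2 (fun p : EuclideanSpace ℂ (Fin n) × EuclideanSpace ℂ (Fin n) =>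
      (√(1 - ‖p.1‖ ^ 2) : ℂ)) (ballAutDomain n) := by
    refine Complex.ofRealCLM.contDiff.comp_contDiffOn (contDiffOn_one_sub_norm_sq.sqrt ?_)
    intro p hp
    have := hp.1
    nlinarith [norm_nonneg p.1]
  have hs0 : ∀ p : EuclideanSpace ℂ (Fin n) × EuclideanSpace ℂ (Fin n), p ∈ ballAutDomain n →
      (1 + √(1 - ‖p.1‖ ^ 2) : ℂ) ≠ 0 := by
    intro p _
    have : (1 + √(1 - ‖p.1‖ ^ 2) : ℝ) ≠ 0 := by positivity
    exact_mod_cast this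
  have h1 : ContDiffOn ℝ 2 (fun p : EuclideanSpace ℂ (Fin n) × EuclideanSpace ℂ (Fin n) =>
      (1 + inner ℂ p.1 p.2)⁻¹) (ballAutDomain n) :=
    (contDiffOn_const.add contDiffOn_one_add_inner).inv fun p hp => hp.2
  have h2 : ContDiffOn ℝ 2 (fun p : EuclideanSpace ℂ (Fin n) × EuclideanSpace ℂ (Fin n) =>
      inner ℂ p.1 p.2 / (1 + √(1 - ‖p.1‖ ^ 2) : ℂ)) (ballAutDomain n) := by
    simp only [div_eq_mul_inv]
    exact contDiffOn_one_add_inner.mul ((contDiffOn_const.add hs).inv hs0)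
  have hf : ContDiffOn ℝ 2 (fun p : EuclideanSpace ℂ (Fin n) × EuclideanSpace ℂ (Fin n) => p.1)
      (ballAutDomain n) := contDiff_fst.contDiffOn
  have hg : ContDiffOn ℝ 2 (fun p : EuclideanSpace ℂ (Fin n) × EuclideanSpace ℂ (Fin n) => p.2)
      (ballAutDomain n) := contDiff_snd.contDiffOn
  exact h1.smul ((hf.add (hs.smul hg)).add (h2.smul hf))

lemma contDiffOn_ballAutJac :
    ContDiffOn ℝ 2 (fun p : EuclideanSpace ℂ (Fin n) × EuclideanSpace ℂ (Fin n) =>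
      ballAutJac n p.1 p.2) (ballAutDomain n) := by
  refine ContDiffOn.rpow_const_of_ne (contDiffOn_one_sub_norm_sq.div
    ((contDiffOn_const.add contDiffOn_one_add_inner).norm_sq ℂ) ?_) ?_
  · intro p hp
    have := hp.2
    positivity
  · intro p hp
    have h1 := hp.1
    have h2 := hp.2
    have h3 : 0 < 1 - ‖p.1‖ ^ 2 := by nlinarith [norm_nonneg p.1]
    positivity

lemma contDiffAt_ballAut {a w : EuclideanSpace ℂ (Fin n)} (h : 1 + inner ℂ a w ≠ 0) :
    ContDiffAt ℂ 2 (ballAut a) w := by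
  have hi : ContDiffAt ℂ 2 (fun w : EuclideanSpace ℂ (Fin n) => inner ℂ a w) w :=
    (innerSL ℂ a).contDiff.contDiffAt
  have h1 : ContDiffAt ℂ 2 (fun w : EuclideanSpace ℂ (Fin n) => (1 + inner ℂ a w)⁻¹) w :=
    (contDiffAt_const.add hi).inv h
  have h2 : ContDiffAt ℂ 2 (fun w : EuclideanSpace ℂ (Fin n) =>
      inner ℂ a w / (1 + √(1 - ‖a‖ ^ 2) : ℂ)) w := hi.div_const _
  have h3 : ContDiffAt ℂ 2 (fun w : EuclideanSpace ℂ (Fin n) => (√(1 - ‖a‖ ^ 2) : ℂ) • w) w :=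
    contDiffAt_fun_id.const_smul _
  exact h1.smul ((contDiffAt_const.add h3).add (h2.smul contDiffAt_const))

open Matrix

/-- The complex conjugate of the Jacobian matrix of `ballAut a` at `w`. -/
noncomputable def ballAutConjMatrix (a w : EuclideanSpace ℂ (Fin n)) : Matrix (Fin n) (Fin n) ℂ :=
  (star (1 + inner ℂ a w)⁻¹) • ((√(1 - ‖a‖ ^ 2) : ℂ) • 1 + replicateCol Unit
    (star (((1 + √(1 - ‖a‖ ^ 2) : ℂ)⁻¹ • a - ballAut a w).ofLp)) * replicateRow Unit a.ofLp)

lemma fderiv_ballAut {a w : EuclideanSpace ℂ (Fin n)} (h : 1 + inner ℂ a w ≠ 0)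
    (v : EuclideanSpace ℂ (Fin n)) :
    fderiv ℂ (ballAut a) w v = (1 + inner ℂ a w)⁻¹ • ((√(1 - ‖a‖ ^ 2) : ℂ) • v +
      inner ℂ a v • ((1 + √(1 - ‖a‖ ^ 2) : ℂ)⁻¹ • a - ballAut a w)) := by
  have hi : HasFDerivAt (fun w : EuclideanSpace ℂ (Fin n) => inner ℂ a w) (innerSL ℂ a) w :=
    (innerSL ℂ a).hasFDerivAt
  have hT := ((contDiffAt_ballAut h).differentiableAt two_ne_zero).hasFDerivAt
  have d1 := (hi.const_add 1).smul hT
  have d2 : HasFDerivAt (fun w : EuclideanSpace ℂ (Fin n) => a + (√(1 - ‖a‖ ^ 2) : ℂ) • w +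
      (inner ℂ a w * (1 + √(1 - ‖a‖ ^ 2) : ℂ)⁻¹) • a) _ w :=
    (((hasFDerivAt_id w).const_smul (√(1 - ‖a‖ ^ 2) : ℂ)).const_add a).add
      ((hi.mul_const (1 + √(1 - ‖a‖ ^ 2) : ℂ)⁻¹).smul_const a)
  have he : (fun w : EuclideanSpace ℂ (Fin n) => (1 + inner ℂ a w) • ballAut a w) =ᶠ[nhds w]
      fun w => a + (√(1 - ‖a‖ ^ 2) : ℂ) • w +
        (inner ℂ a w * (1 + √(1 - ‖a‖ ^ 2) : ℂ)⁻¹) • a := by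
    filter_upwards [(continuousAt_const.add hi.continuousAt).eventually_ne h] with y hy
    change 1 + inner ℂ a y ≠ 0 at hy
    rw [ballAut, smul_smul, mul_inv_cancel₀ hy, one_smul, div_eq_mul_inv]
  have key := congrArg (fun L => L v) (d1.unique (d2.congr_of_eventuallyEq he))
  simp at key
  rw [eq_inv_smul_iff₀ h, eq_sub_of_add_eq key]
  module

lemma star_fderiv_ballAut {a w : EuclideanSpace ℂ (Fin n)} (h : 1 + inner ℂ a w ≠ 0)
    (v : EuclideanSpace ℂ (Fin n)) :
    star (fderiv ℂ (ballAut a) w v).ofLp = ballAutConjMatrix a w *ᵥ star v.ofLp := by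
  rw [fderiv_ballAut h]
  ext k
  simp only [ballAutConjMatrix, Matrix.smul_mulVec, Matrix.add_mulVec, ← Matrix.mulVec_mulVec,
    Matrix.one_mulVec, EuclideanSpace.inner_eq_star_dotProduct]
  simp only [mulVec, dotProduct, WithLp.ofLp_smul, WithLp.ofLp_add, WithLp.ofLp_sub, Pi.star_apply,
    Pi.smul_apply, Pi.add_apply, Pi.sub_apply, smul_eq_mul, star_mul', star_add, star_sum,
    replicateCol_apply, replicateRow_apply, Finset.univ_unique,
    Finset.sum_singleton, Complex.star_def, Complex.conj_ofReal]
  rw [Finset.sum_mul]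
  congr 2
  rw [Finset.mul_sum]
  refine Finset.sum_congr rfl fun i _ => ?_
  rw [Complex.conj_conj]
  ring

lemma normSq_det_ballAutConjMatrix {a w : EuclideanSpace ℂ (Fin n)} (ha : ‖a‖ < 1) (hw : ‖w‖ ≤ 1) :
    ‖(ballAutConjMatrix a w).det‖ ^ 2 =
      ((1 - ‖a‖ ^ 2) / ‖1 + inner ℂ a w‖ ^ 2) ^ (n + 1) := by
  have hne := one_add_inner_ne_zero ha hw
  have hs2 : 0 < 1 - ‖a‖ ^ 2 := by nlinarith [norm_nonneg a]
  set s := √(1 - ‖a‖ ^ 2) with hs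
  have hs0 : 0 < s := Real.sqrt_pos.2 hs2
  have hss : s ^ 2 = 1 - ‖a‖ ^ 2 := Real.sq_sqrt hs2.le
  have hsC : (s : ℂ) ≠ 0 := by exact_mod_cast hs0.ne'
  have hs1 : (1 + s : ℂ) ≠ 0 := by
    have : (1 + s : ℝ) ≠ 0 := by positivity
    exact_mod_cast this
  set q := (1 + s : ℂ)⁻¹ • a - ballAut a w with hq
  have haa : inner ℂ a a = 1 - (s : ℂ) ^ 2 := by
    rw [inner_self_eq_norm_sq_to_K, ← Complex.ofReal_pow, hss]
    simp
  have hinner : inner ℂ a q = -s + s ^ 2 / (1 + inner ℂ a w) := by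
    rw [hq, ballAut, ← hs]
    simp only [inner_sub_right, inner_smul_right, inner_add_right, haa]
    field_simp
    ring
  have hM : ballAutConjMatrix a w = (star (1 + inner ℂ a w)⁻¹ * s) •
      (1 + replicateCol Unit ((s : ℂ)⁻¹ • star q.ofLp) * replicateRow Unit a.ofLp) := by
    rw [ballAutConjMatrix, ← hs, ← hq, mul_smul, replicateCol_smul, Matrix.smul_mul, smul_add (s : ℂ),
      smul_smul, mul_inv_cancel₀ hsC, one_smul]
  have hdot : 1 + a.ofLp ⬝ᵥ ((s : ℂ)⁻¹ • star q.ofLp) = star (s / (1 + inner ℂ a w)) := by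
    have : a.ofLp ⬝ᵥ star q.ofLp = star (inner ℂ a q) := by
      rw [EuclideanSpace.inner_eq_star_dotProduct]
      simp [dotProduct, mul_comm]
    rw [dotProduct_smul, this, hinner]
    simp
    field_simp
    ring
  rw [hM, det_smul, det_one_add_replicateCol_mul_replicateRow, hdot, Fintype.card_fin, norm_mul,
    norm_pow, norm_mul, norm_star, norm_star, norm_inv, norm_div, Complex.norm_real,
    Real.norm_of_nonneg hs0.le, ← hss, ← div_pow, inv_mul_eq_div]
  ring

end BallAutomorphism

section SecondDifference

variable {E F : Type*} [NormedAddCommGroup E] [NormedSpace ℝ E] [NormedAddCommGroup F]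
  [NormedSpace ℝ F]

lemma norm_taylor_one_le_of_holder {f : E → F} {s : Set E} (hs : Convex ℝ s)
    (hf : ∀ p ∈ s, DifferentiableAt ℝ f p) {K α : ℝ} (hK : 0 ≤ K) (hα : 0 < α)
    (hh : ∀ p ∈ s, ∀ q ∈ s, ‖fderiv ℝ f p - fderiv ℝ f q‖ ≤ K * ‖p - q‖ ^ α)
    {p q : E} (hp : p ∈ s) (hq : q ∈ s) :
    ‖f q - f p - fderiv ℝ f p (q - p)‖ ≤ K * ‖q - p‖ ^ (1 + α) := by
  have hss : segment ℝ p q ⊆ s := hs.segment_subset hp hq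
  have h := (convex_segment p q).norm_image_sub_le_of_norm_fderiv_le' (𝕜 := ℝ)
    (φ := fderiv ℝ f p) (C := K * ‖q - p‖ ^ α) (fun x hx => hf x (hss hx))
    (fun x hx => (hh x (hss hx) p hp).trans (mul_le_mul_of_nonneg_left
      (Real.rpow_le_rpow (norm_nonneg _) (norm_sub_le_of_mem_segment hx) hα.le) hK))
    (left_mem_segment ℝ p q) (right_mem_segment ℝ p q)
  rwa [mul_assoc, mul_comm (‖q - p‖ ^ α), ← Real.rpow_one_add' (norm_nonneg _) (by positivity)] at h

lemma abs_second_difference_le_of_holder {f : E → ℝ} {s : Set E} (hs : Convex ℝ s)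
    (hf : ∀ p ∈ s, DifferentiableAt ℝ f p) {K L α : ℝ} (hK : 0 ≤ K) (hα : 0 < α)
    (hh : ∀ p ∈ s, ∀ q ∈ s, ‖fderiv ℝ f p - fderiv ℝ f q‖ ≤ K * ‖p - q‖ ^ α)
    (hL : ∀ p ∈ s, ‖fderiv ℝ f p‖ ≤ L) {p q r : E} (hp : p ∈ s) (hq : q ∈ s) (hr : r ∈ s) :
    |f p + f q - 2 * f r| ≤
      2 * K * ‖(1 / 2 : ℝ) • (p - q)‖ ^ (1 + α) + L * ‖p + q - (2 : ℝ) • r‖ := by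
  set m := (1 / 2 : ℝ) • (p + q) with hm
  have hms : m ∈ s := by
    rw [hm, smul_add]
    exact hs hp hq (by norm_num) (by norm_num) (by norm_num)
  have hpm : p - m = (1 / 2 : ℝ) • (p - q) := by rw [hm]; module
  have hqm : q - m = -((1 / 2 : ℝ) • (p - q)) := by rw [hm]; module
  have h1 := norm_taylor_one_le_of_holder hs hf hK hα hh hms hp
  have h2 := norm_taylor_one_le_of_holder hs hf hK hα hh hms hq
  have h3 := hs.norm_image_sub_le_of_norm_fderiv_le hf hL hr hms
  have h4 : ‖p + q - (2 : ℝ) • r‖ = 2 * ‖m - r‖ := by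
    rw [show p + q - (2 : ℝ) • r = (2 : ℝ) • (m - r) by rw [hm]; module, norm_smul]
    norm_num
  rw [hpm] at h1
  rw [hqm, map_neg, norm_neg] at h2
  rw [Real.norm_eq_abs, abs_le] at h1 h2 h3
  rw [h4, abs_le]
  constructor <;> linarith [h1.1, h1.2, h2.1, h2.2, h3.1, h3.2]

lemma exists_second_difference_bound {G : E → F} {O S : Set E} (hO : IsOpen O)
    (hG : ContDiffOn ℝ 2 G O) (hSO : S ⊆ O) (hS : IsCompact S) (hSc : Convex ℝ S) :
    ∃ C, 1 ≤ C ∧ (∀ p ∈ S, ‖G p‖ ≤ C) ∧ (∀ p ∈ S, ∀ q ∈ S, ‖G p - G q‖ ≤ C * ‖p - q‖) ∧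
      ∀ p d, p ∈ S → p + d ∈ S → p - d ∈ S →
        ‖G (p + d) + G (p - d) - (2 : ℝ) • G p‖ ≤ C * ‖d‖ ^ 2 := by
  obtain ⟨A, hA⟩ := hS.exists_bound_of_continuousOn (hG.continuousOn.mono hSO)
  obtain ⟨K₁, hK₁⟩ := (hG.mono hSO).exists_lipschitzOnWith two_ne_zero hSc hS
  obtain ⟨K₂, hK₂⟩ := ((hG.fderiv_of_isOpen (m := 1) hO (by norm_num)).mono
    hSO).exists_lipschitzOnWith one_ne_zero hSc hS
  have hd : ∀ p ∈ S, DifferentiableAt ℝ G p := fun p hp =>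
    (hG.contDiffAt (hO.mem_nhds (hSO hp))).differentiableAt two_ne_zero
  have hh : ∀ p ∈ S, ∀ q ∈ S, ‖fderiv ℝ G p - fderiv ℝ G q‖ ≤ K₂ * ‖p - q‖ ^ (1 : ℝ) := by
    intro p hp q hq
    rw [Real.rpow_one]
    exact hK₂.norm_sub_le hp hq
  refine ⟨1 + |A| + K₁ + 2 * K₂, ?_, ?_, ?_, ?_⟩
  · have := abs_nonneg A
    have := K₁.2
    have := K₂.2
    simp only [NNReal.val_eq_coe] at *
    linarith
  · intro p hp
    linarith [hA p hp, le_abs_self A, K₁.coe_nonneg, K₂.coe_nonneg]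
  · intro p hp q hq
    refine (hK₁.norm_sub_le hp hq).trans (mul_le_mul_of_nonneg_right ?_ (norm_nonneg _))
    linarith [abs_nonneg A, K₂.coe_nonneg]
  · intro p d hp h1 h2
    have e1 := norm_taylor_one_le_of_holder hSc hd K₂.coe_nonneg one_pos hh hp h1
    have e2 := norm_taylor_one_le_of_holder hSc hd K₂.coe_nonneg one_pos hh hp h2
    have e3 : G (p + d) + G (p - d) - (2 : ℝ) • G p =
        (G (p + d) - G p - fderiv ℝ G p (p + d - p)) +
          (G (p - d) - G p - fderiv ℝ G p (p - d - p)) := by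
      rw [add_sub_cancel_left, show p - d - p = -d by abel, map_neg, two_smul]
      abel
    rw [add_sub_cancel_left, one_add_one_eq_two, Real.rpow_two] at e1
    rw [show p - d - p = -d by abel, norm_neg, one_add_one_eq_two, Real.rpow_two] at e2
    rw [add_sub_cancel_left, show p - d - p = -d by abel] at e3
    rw [e3]
    refine (norm_add_le _ _).trans ((add_le_add e1 e2).trans ?_)
    have := mul_nonneg (by positivity : (0 : ℝ) ≤ 1 + |A| + K₁) (sq_nonneg ‖d‖)
    linarith

end SecondDifference

section ParameterSecondDifference

variable {n : ℕ} {F : Type*} [NormedAddCommGroup F] [NormedSpace ℝ F]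

lemma exists_parameter_second_difference_bound
    {G : EuclideanSpace ℂ (Fin n) × EuclideanSpace ℂ (Fin n) → F}
    (hG : ContDiffOn ℝ 2 G (ballAutDomain n)) {r : ℝ} (hr : r < 1) :
    ∃ C, 1 ≤ C ∧ ∀ x y w : EuclideanSpace ℂ (Fin n), ‖x‖ + ‖y‖ ≤ r → ‖w‖ ≤ 1 →
      ‖G (x, w)‖ ≤ C ∧ ‖G (x + y, w) - G (x, w)‖ ≤ C * ‖y‖ ∧
      ‖G (x - y, w) - G (x, w)‖ ≤ C * ‖y‖ ∧
      ‖(1 / 2 : ℝ) • (G (x + y, w) - G (x - y, w))‖ ≤ C * ‖y‖ ∧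
      ‖G (x + y, w) + G (x - y, w) - (2 : ℝ) • G (x, w)‖ ≤ C * ‖y‖ ^ 2 := by
  obtain ⟨C, hC, hb, hl, hs⟩ := exists_second_difference_bound isOpen_ballAutDomain hG
    (S := closedBall (0 : EuclideanSpace ℂ (Fin n)) r ×ˢ closedBall 0 1)
    (fun p hp => by
      rw [mem_prod, mem_closedBall_zero_iff, mem_closedBall_zero_iff] at hp
      exact ⟨hp.1.trans_lt hr, one_add_inner_ne_zero (hp.1.trans_lt hr) hp.2⟩)
    ((isCompact_closedBall _ _).prod (isCompact_closedBall _ _))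
    ((convex_closedBall _ _).prod (convex_closedBall _ _))
  refine ⟨C, hC, fun x y w hxy hw => ?_⟩
  have hmem : ∀ a : EuclideanSpace ℂ (Fin n), ‖a‖ ≤ r →
      (a, w) ∈ closedBall (0 : EuclideanSpace ℂ (Fin n)) r ×ˢ closedBall 0 1 := fun a ha =>
    ⟨mem_closedBall_zero_iff.2 ha, mem_closedBall_zero_iff.2 hw⟩
  have h0 := hmem x (by linarith [norm_nonneg y])
  have h1 := hmem (x + y) ((norm_add_le x y).trans hxy)
  have h2 := hmem (x - y) ((norm_sub_le x y).trans hxy)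
  have hd : ∀ a, ‖((a, 0) : EuclideanSpace ℂ (Fin n) × EuclideanSpace ℂ (Fin n))‖ = ‖a‖ := by
    simp [Prod.norm_def]
  have e1 := hl _ h1 _ h0
  have e2 := hl _ h2 _ h0
  have e3 := hs (x, w) (y, 0) h0 (by simpa using h1) (by simpa using h2)
  rw [Prod.mk_sub_mk, sub_self, add_sub_cancel_left, hd] at e1
  rw [Prod.mk_sub_mk, sub_self, show x - y - x = -y by abel, hd, norm_neg] at e2
  rw [hd, Prod.mk_add_mk, Prod.mk_sub_mk, add_zero, sub_zero] at e3
  refine ⟨hb _ h0, e1, e2, ?_, e3⟩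
  rw [norm_smul, ← sub_sub_sub_cancel_right _ _ (G (x, w)), Real.norm_of_nonneg (by norm_num)]
  have := norm_sub_le (G (x + y, w) - G (x, w)) (G (x - y, w) - G (x, w))
  linarith

lemma sq_le_rpow_one_add {h α : ℝ} (h0 : 0 ≤ h) (h1 : h ≤ 1) (_ : 0 < α) (hα : α ≤ 1) :
    h ^ 2 ≤ h ^ (1 + α) := by
  rw [← Real.rpow_two]
  exact Real.rpow_le_rpow_of_exponent_ge_of_imp h0 h1 (by linarith) fun _ h => by linarith

lemma exists_second_difference_comp_ballAut_le (n : ℕ) {r : ℝ} (hr : r < 1) :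
    ∃ C, 0 ≤ C ∧ ∀ α : ℝ, 0 < α → α ≤ 1 → ∀ (f : EuclideanSpace ℂ (Fin n) → ℝ) (K L : ℝ),
      0 ≤ K → 0 ≤ L → (∀ p ∈ ball (0 : EuclideanSpace ℂ (Fin n)) 1, DifferentiableAt ℝ f p) →
      (∀ p ∈ ball (0 : EuclideanSpace ℂ (Fin n)) 1, ∀ q ∈ ball (0 : EuclideanSpace ℂ (Fin n)) 1,
        ‖fderiv ℝ f p - fderiv ℝ f q‖ ≤ K * ‖p - q‖ ^ α) →
      (∀ p ∈ ball (0 : EuclideanSpace ℂ (Fin n)) 1, ‖fderiv ℝ f p‖ ≤ L) →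
      ∀ x y w : EuclideanSpace ℂ (Fin n), ‖x‖ + ‖y‖ ≤ r → ‖w‖ < 1 →
        |f (ballAut (x + y) w) + f (ballAut (x - y) w) - 2 * f (ballAut x w)| ≤
          C * (K + L) * ‖y‖ ^ (1 + α) := by
  obtain ⟨C, hC, hG⟩ := exists_parameter_second_difference_bound (contDiffOn_ballAut (n := n)) hr
  refine ⟨2 * C ^ 2, by positivity, fun α hα0 hα f K L hK hL hf hh hb x y w hxy hw => ?_⟩
  obtain ⟨-, -, -, h3, h4⟩ := hG x y w hxy hw.le
  have hmem : ∀ a : EuclideanSpace ℂ (Fin n), ‖a‖ ≤ r →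
      ballAut a w ∈ ball (0 : EuclideanSpace ℂ (Fin n)) 1 := fun a ha =>
    mem_ball_zero_iff.2 (norm_ballAut_lt_one (ha.trans_lt hr) hw)
  have hy1 : ‖y‖ ≤ 1 := by linarith [norm_nonneg x]
  refine (abs_second_difference_le_of_holder (convex_ball _ _) hf hK hα0 hh hb
    (hmem (x + y) ((norm_add_le x y).trans hxy)) (hmem (x - y) ((norm_sub_le x y).trans hxy))
    (hmem x (by linarith [norm_nonneg y]))).trans ?_
  have hy := sq_le_rpow_one_add (norm_nonneg y) hy1 hα0 hα
  have e1 := Real.rpow_le_rpow (norm_nonneg _) h3 (by linarith : 0 ≤ 1 + α)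
  rw [Real.mul_rpow (by linarith) (norm_nonneg y)] at e1
  have e2 : C ^ (1 + α) ≤ C ^ 2 := by
    rw [← Real.rpow_two]
    exact Real.rpow_le_rpow_of_exponent_le hC (by linarith)
  have hyp : 0 ≤ ‖y‖ ^ (1 + α) := by positivity
  have e3 := e1.trans (mul_le_mul_of_nonneg_right e2 hyp)
  have e4 : C * ‖y‖ ^ 2 ≤ 2 * C ^ 2 * ‖y‖ ^ (1 + α) :=
    mul_le_mul (by nlinarith) hy (sq_nonneg _) (by positivity)
  have e5 := mul_le_mul_of_nonneg_left e3 (by positivity : 0 ≤ 2 * K)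
  have e6 := mul_le_mul_of_nonneg_left (h4.trans e4) hL
  linarith

lemma abs_second_difference_mul_le {j₁ j₂ j₀ g₁ g₂ g₀ : ℝ} {A B D M a b d : ℝ}
    (hj₀ : |j₀| ≤ A) (hg : |g₁ + g₂ - 2 * g₀| ≤ B) (h1 : |j₁ - j₀| ≤ a) (h2 : |j₂ - j₀| ≤ a)
    (h3 : |g₁ - g₀| ≤ b) (h4 : |g₂ - g₀| ≤ b) (hg₀ : |g₀| ≤ M) (hj : |j₁ + j₂ - 2 * j₀| ≤ D)
    (hd : A * B + a * b + a * b + M * D ≤ d) :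
    |j₁ * g₁ + j₂ * g₂ - 2 * (j₀ * g₀)| ≤ d := by
  have e : j₁ * g₁ + j₂ * g₂ - 2 * (j₀ * g₀) = j₀ * (g₁ + g₂ - 2 * g₀) + (j₁ - j₀) * (g₁ - g₀) +
      (j₂ - j₀) * (g₂ - g₀) + g₀ * (j₁ + j₂ - 2 * j₀) := by ring
  have key : ∀ {s t S T : ℝ}, |s| ≤ S → |t| ≤ T → |s * t| ≤ S * T := fun hs ht => by
    rw [abs_mul]
    exact mul_le_mul hs ht (abs_nonneg _) ((abs_nonneg _).trans hs)
  rw [e]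
  refine (abs_add_le _ _).trans (le_trans ?_ hd)
  refine add_le_add ((abs_add_le _ _).trans ?_) (key hg₀ hj)
  exact add_le_add ((abs_add_le _ _).trans (add_le_add (key hj₀ hg) (key h1 h3))) (key h2 h4)

lemma exists_second_difference_ballAutJac_mul_le (n : ℕ) {r : ℝ} (hr : r < 1) :
    ∃ C, 0 ≤ C ∧ ∀ α : ℝ, 0 < α → α ≤ 1 →
      ∀ (g : EuclideanSpace ℂ (Fin n) → ℝ) (K₀ K₁ K₂ : ℝ), 0 ≤ K₀ → 0 ≤ K₁ → 0 ≤ K₂ →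
      (∀ p ∈ ball (0 : EuclideanSpace ℂ (Fin n)) 1, DifferentiableAt ℝ g p) →
      (∀ p ∈ ball (0 : EuclideanSpace ℂ (Fin n)) 1, |g p| ≤ K₀) →
      (∀ p ∈ ball (0 : EuclideanSpace ℂ (Fin n)) 1, ‖fderiv ℝ g p‖ ≤ K₁) →
      (∀ p ∈ ball (0 : EuclideanSpace ℂ (Fin n)) 1, ∀ q ∈ ball (0 : EuclideanSpace ℂ (Fin n)) 1,
        ‖fderiv ℝ g p - fderiv ℝ g q‖ ≤ K₂ * ‖p - q‖ ^ α) →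
      ∀ x y w : EuclideanSpace ℂ (Fin n), ‖x‖ + ‖y‖ ≤ r → ‖w‖ < 1 →
        |ballAutJac n (x + y) w * g (ballAut (x + y) w) +
            ballAutJac n (x - y) w * g (ballAut (x - y) w) -
            2 * (ballAutJac n x w * g (ballAut x w))| ≤
          C * (K₀ + K₁ + K₂) * ‖y‖ ^ (1 + α) := by
  obtain ⟨C₁, hC₁, h₁⟩ := exists_second_difference_comp_ballAut_le n hr
  obtain ⟨C₂, hC₂, h₂⟩ := exists_parameter_second_difference_bound (contDiffOn_ballAut (n := n)) hr
  obtain ⟨C₃, hC₃, h₃⟩ :=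
    exists_parameter_second_difference_bound (contDiffOn_ballAutJac (n := n)) hr
  refine ⟨C₃ * C₁ + 2 * (C₃ * C₂) + C₃, by positivity,
    fun α hα0 hα g K₀ K₁ K₂ hK₀ hK₁ hK₂ hd hb0 hb1 hb2 x y w hxy hw => ?_⟩
  obtain ⟨-, a1, a2, -, -⟩ := h₂ x y w hxy hw.le
  obtain ⟨b0, b1, b2, -, b4⟩ := h₃ x y w hxy hw.le
  simp only [Real.norm_eq_abs, smul_eq_mul] at b0 b1 b2 b4
  have hmem : ∀ a : EuclideanSpace ℂ (Fin n), ‖a‖ ≤ r →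
      ballAut a w ∈ ball (0 : EuclideanSpace ℂ (Fin n)) 1 := fun a ha =>
    mem_ball_zero_iff.2 (norm_ballAut_lt_one (ha.trans_lt hr) hw)
  have m0 := hmem x (by linarith [norm_nonneg y])
  have m1 := hmem (x + y) ((norm_add_le x y).trans hxy)
  have m2 := hmem (x - y) ((norm_sub_le x y).trans hxy)
  have g1 := (convex_ball _ _).norm_image_sub_le_of_norm_fderiv_le hd hb1 m0 m1
  have g2 := (convex_ball _ _).norm_image_sub_le_of_norm_fderiv_le hd hb1 m0 m2
  have hy1 : ‖y‖ ≤ 1 := by linarith [norm_nonneg x]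
  have hy := sq_le_rpow_one_add (norm_nonneg y) hy1 hα0 hα
  refine abs_second_difference_mul_le b0
    (h₁ α hα0 hα g K₂ K₁ hK₂ hK₁ hd hb2 hb1 x y w hxy hw) b1 b2
    (g1.trans (mul_le_mul_of_nonneg_left a1 hK₁)) (g2.trans (mul_le_mul_of_nonneg_left a2 hK₁))
    (hb0 _ m0) b4 ?_
  have hyp : 0 ≤ ‖y‖ ^ (1 + α) := by positivity
  have e1 := mul_le_mul_of_nonneg_left hy (by positivity : 0 ≤ 2 * (C₃ * C₂ * K₁) + K₀ * C₃)
  have e2 : 0 ≤ (C₃ * C₁ * K₀ + 2 * (C₃ * C₂) * (K₀ + K₂) + C₃ * (K₁ + K₂)) * ‖y‖ ^ (1 + α) := by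
    positivity
  linarith

end ParameterSecondDifference

section PointwiseUpperBound

open Matrix

variable {n : ℕ}

lemma dotProduct_conjTranspose_mul_mul_mulVec (N H : Matrix (Fin n) (Fin n) ℂ) (x : Fin n → ℂ) :
    star x ⬝ᵥ (Nᴴ * H * N) *ᵥ x = star (N *ᵥ x) ⬝ᵥ H *ᵥ (N *ᵥ x) := by
  rw [star_mulVec, ← dotProduct_mulVec, mulVec_mulVec, mulVec_mulVec, Matrix.mul_assoc]

/-- The matrix of the Levi form of `u ∘ ballAut a` at `w`. -/
noncomputable def pullbackHessian (u : EuclideanSpace ℂ (Fin n) → ℝ)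
    (a w : EuclideanSpace ℂ (Fin n)) : Matrix (Fin n) (Fin n) ℂ :=
  (ballAutConjMatrix a w)ᴴ * cxHessian n u (ballAut a w) * ballAutConjMatrix a w

lemma re_dotProduct_pullbackHessian {u : EuclideanSpace ℂ (Fin n) → ℝ}
    {a w : EuclideanSpace ℂ (Fin n)} (ha : ‖a‖ < 1) (hw : ‖w‖ < 1)
    (hu : ContDiffAt ℝ 2 u (ballAut a w)) (v : EuclideanSpace ℂ (Fin n)) :
    (v.ofLp ⬝ᵥ pullbackHessian u a w *ᵥ star v.ofLp).re =
      leviForm (fun w => u (ballAut a w)) w v / 4 := by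
  have hne := one_add_inner_ne_zero ha hw.le
  have h := dotProduct_conjTranspose_mul_mul_mulVec (ballAutConjMatrix a w)
    (cxHessian n u (ballAut a w)) (star v.ofLp)
  rw [star_star, ← star_fderiv_ballAut hne, star_star] at h
  rw [pullbackHessian, h, re_dotProduct_cxHessian_mulVec hu,
    leviForm_comp hu (contDiffAt_ballAut hne)]

lemma det_pullbackHessian_rpow {u f : EuclideanSpace ℂ (Fin n) → ℝ}
    {a w : EuclideanSpace ℂ (Fin n)} (ha : ‖a‖ < 1) (hw : ‖w‖ < 1)
    (hdet : (cxHessian n u (ballAut a w)).det = (f (ballAut a w) : ℂ))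
    (hf : 0 ≤ f (ballAut a w)) :
    (pullbackHessian u a w).det.re ^ ((n : ℝ)⁻¹) =
      ballAutJac n a w * f (ballAut a w) ^ ((n : ℝ)⁻¹) := by
  have h1 : (pullbackHessian u a w).det =
      ((‖(ballAutConjMatrix a w).det‖ ^ 2 * f (ballAut a w) : ℝ) : ℂ) := by
    rw [pullbackHessian, det_mul, det_mul, det_conjTranspose, hdet, Complex.star_def]
    push_cast
    rw [← Complex.conj_mul']
    ring
  have hs : 0 < 1 - ‖a‖ ^ 2 := by nlinarith [norm_nonneg a]
  have hq : 0 ≤ (1 - ‖a‖ ^ 2) / ‖1 + inner ℂ a w‖ ^ 2 := by positivity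
  rw [h1, Complex.ofReal_re, normSq_det_ballAutConjMatrix ha hw.le,
    Real.mul_rpow (by positivity) hf, ballAutJac, Real.rpow_mul hq, ← Real.rpow_natCast]
  push_cast
  rfl

lemma second_difference_le_of_boundary_le (hn : 0 < n) {u f : EuclideanSpace ℂ (Fin n) → ℝ}
    (hu : ContDiffOn ℝ 2 u (ball 0 1)) (huc : ContinuousOn u (closedBall 0 1))
    (hpsh : ∀ z ∈ ball (0 : EuclideanSpace ℂ (Fin n)) 1, (cxHessian n u z).PosSemidef)
    (hdet : ∀ z ∈ ball (0 : EuclideanSpace ℂ (Fin n)) 1, (cxHessian n u z).det = (f z : ℂ))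
    (hf : ∀ z ∈ ball (0 : EuclideanSpace ℂ (Fin n)) 1, 0 ≤ f z)
    (l : EuclideanSpace ℂ (Fin n) →L[ℝ] ℝ) {x y : EuclideanSpace ℂ (Fin n)}
    (hxy : ‖x‖ + ‖y‖ < 1) {M D : ℝ} (hD : 0 ≤ D)
    (hM : ∀ w ∈ sphere (0 : EuclideanSpace ℂ (Fin n)) 1,
      (u (ballAut (x + y) w) + l (ballAut (x + y) w)) +
        (u (ballAut (x - y) w) + l (ballAut (x - y) w)) -
        2 * (u (ballAut x w) + l (ballAut x w)) ≤ M)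
    (hg : ∀ w ∈ ball (0 : EuclideanSpace ℂ (Fin n)) 1,
      -D ≤ ballAutJac n (x + y) w * f (ballAut (x + y) w) ^ ((n : ℝ)⁻¹) +
        ballAutJac n (x - y) w * f (ballAut (x - y) w) ^ ((n : ℝ)⁻¹) -
        2 * (ballAutJac n x w * f (ballAut x w) ^ ((n : ℝ)⁻¹))) :
    u (x + y) + u (x - y) - 2 * u x ≤ M + D := by
  have : Nonempty (Fin n) := ⟨⟨0, hn⟩⟩
  have hx₁ : ‖x + y‖ < 1 := (norm_add_le x y).trans_lt hxy
  have hx₂ : ‖x - y‖ < 1 := (norm_sub_le x y).trans_lt hxy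
  have hx₀ : ‖x‖ < 1 := by linarith [norm_nonneg y]
  refine le_of_forall_pos_le_add fun ε hε => ?_
  set c := (D + ε) / 2 with hc
  have hc0 : 0 < c := by positivity
  set U : EuclideanSpace ℂ (Fin n) → ℝ := fun z => u z + l z with hU
  have hud : ∀ z ∈ ball (0 : EuclideanSpace ℂ (Fin n)) 1, ContDiffAt ℝ 2 u z :=
    fun z hz => hu.contDiffAt (isOpen_ball.mem_nhds hz)
  have hUd : ∀ z ∈ ball (0 : EuclideanSpace ℂ (Fin n)) 1, ContDiffAt ℝ 2 U z :=
    fun z hz => (hud z hz).add l.contDiff.contDiffAt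
  have hT : ∀ {a w : EuclideanSpace ℂ (Fin n)}, ‖a‖ < 1 → w ∈ ball 0 1 →
      ballAut a w ∈ ball (0 : EuclideanSpace ℂ (Fin n)) 1 := fun ha hw =>
    mem_ball_zero_iff.2 (norm_ballAut_lt_one ha (mem_ball_zero_iff.1 hw))
  have hTd : ∀ {a w : EuclideanSpace ℂ (Fin n)}, ‖a‖ < 1 → ‖w‖ ≤ 1 →
      ContDiffAt ℂ 2 (ballAut a) w := fun ha hw =>
    contDiffAt_ballAut (one_add_inner_ne_zero ha hw)
  have hUT : ∀ {a w : EuclideanSpace ℂ (Fin n)}, ‖a‖ < 1 → w ∈ ball 0 1 →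
      ContDiffAt ℝ 2 (fun w => U (ballAut a w)) w := fun ha hw =>
    (hUd _ (hT ha hw)).comp _ ((hTd ha (mem_ball_zero_iff.1 hw).le).restrict_scalars ℝ)
  have hlevi : ∀ {a w : EuclideanSpace ℂ (Fin n)}, ‖a‖ < 1 → w ∈ ball 0 1 → ∀ v,
      leviForm (fun w => U (ballAut a w)) w v = leviForm (fun w => u (ballAut a w)) w v := by
    intro a w ha hw v
    have hw' := (mem_ball_zero_iff.1 hw).le
    rw [leviForm_comp (hUd _ (hT ha hw)) (hTd ha hw'),
      leviForm_comp (hud _ (hT ha hw)) (hTd ha hw'), hU,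
      leviForm_add (hud _ (hT ha hw)) l.contDiff.contDiffAt, leviForm_clm, add_zero]
  have hUc : ∀ {a : EuclideanSpace ℂ (Fin n)}, ‖a‖ < 1 →
      ContinuousOn (fun w => U (ballAut a w)) (closedBall 0 1) := fun ha =>
    (huc.add l.continuous.continuousOn).comp
      (fun w hw => (hTd ha (mem_closedBall_zero_iff.1 hw)).continuousAt.continuousWithinAt)
      (fun w hw => mem_closedBall_zero_iff.2 (norm_ballAut_le_one ha (mem_closedBall_zero_iff.1 hw)))
  set W : EuclideanSpace ℂ (Fin n) → ℝ := fun w =>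
    ((U (ballAut (x + y) w) + U (ballAut (x - y) w)) + (-2) * U (ballAut x w)) +
      (2 * c) * ‖w‖ ^ 2 with hW
  have hnorm : ContDiff ℝ 2 (fun w : EuclideanSpace ℂ (Fin n) => ‖w‖ ^ 2) := contDiff_norm_sq ℝ
  have key := le_of_exists_fderiv_fderiv_pos (W := W) (M := M + 2 * c) ?_ ?_ ?_ ?_
  · simp only [hW, hU, ballAut_zero, map_add, map_sub, norm_zero] at key
    linarith
  · exact (((hUc hx₁).add (hUc hx₂)).add (continuousOn_const.mul (hUc hx₀))).add
      (continuousOn_const.mul hnorm.continuous.continuousOn)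
  · intro z hz
    exact (((hUT hx₁ hz).add (hUT hx₂ hz)).add (contDiffAt_const.mul (hUT hx₀ hz))).add
      (contDiffAt_const.mul hnorm.contDiffAt)
  · intro z hz
    have := hM z hz
    simp only [hW, hU, mem_sphere_zero_iff_norm.1 hz]
    linarith
  · intro w hw
    have hw' := mem_ball_zero_iff.1 hw
    suffices h : ∃ v, 0 < leviForm W w v from
      let ⟨v, hv⟩ := h
      exists_fderiv_fderiv_pos_of_leviForm_pos hv
    by_contra! hle
    have hWl : ∀ v, leviForm W w v = leviForm (fun w => u (ballAut (x + y) w)) w v +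
        leviForm (fun w => u (ballAut (x - y) w)) w v -
        2 * leviForm (fun w => u (ballAut x w)) w v + 8 * c * ‖v‖ ^ 2 := by
      intro v
      rw [hW, leviForm_add (((hUT hx₁ hw).add (hUT hx₂ hw)).add
          (contDiffAt_const.mul (hUT hx₀ hw))) (contDiffAt_const.mul hnorm.contDiffAt),
        leviForm_add ((hUT hx₁ hw).add (hUT hx₂ hw)) (contDiffAt_const.mul (hUT hx₀ hw)),
        leviForm_add (hUT hx₁ hw) (hUT hx₂ hw), leviForm_const_mul (hUT hx₀ hw),
        leviForm_const_mul hnorm.contDiffAt, leviForm_norm_sq, hlevi hx₁ hw, hlevi hx₂ hw,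
        hlevi hx₀ hw]
      ring
    have hpsd : ∀ {a : EuclideanSpace ℂ (Fin n)}, ‖a‖ < 1 → (pullbackHessian u a w).PosSemidef :=
      fun ha => (hpsh _ (hT ha hw)).conjTranspose_mul_mul_same _
    have hdiff : (pullbackHessian u x w - ((1 / 2 : ℂ) • pullbackHessian u (x + y) w +
        (1 / 2 : ℂ) • pullbackHessian u (x - y) w + (c : ℂ) • 1)).PosSemidef := by
      refine posSemidef_of_re_nonneg ?_ fun p => ?_
      · have h2 : IsSelfAdjoint (1 / 2 : ℂ) := by simp [isSelfAdjoint_iff]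
        have h3 : IsSelfAdjoint (c : ℂ) := Complex.conj_ofReal c
        exact (hpsd hx₀).isHermitian.sub ((((hpsd hx₁).isHermitian.smul h2).add
          ((hpsd hx₂).isHermitian.smul h2)).add (isHermitian_one.smul h3))
      · set v : EuclideanSpace ℂ (Fin n) := WithLp.toLp 2 (star p) with hv
        have hvp : star v.ofLp = p := star_star p
        have hq : ∀ {a : EuclideanSpace ℂ (Fin n)}, ‖a‖ < 1 →
            (star p ⬝ᵥ pullbackHessian u a w *ᵥ p).re =
              leviForm (fun w => u (ballAut a w)) w v / 4 := by
          intro a ha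
          rw [← re_dotProduct_pullbackHessian ha hw' (hud _ (hT ha hw)), hvp]
        have hnv : (star p ⬝ᵥ p).re = ‖v‖ ^ 2 := by
          rw [EuclideanSpace.norm_sq_eq, dotProduct, Complex.re_sum]
          refine Finset.sum_congr rfl fun i _ => ?_
          rw [hv, Pi.star_apply, Complex.star_def, Complex.conj_mul', WithLp.ofLp_toLp,
            Pi.star_apply, norm_star]
          norm_cast
        have := hle v
        rw [hWl] at this
        simp only [sub_mulVec, add_mulVec, smul_mulVec, one_mulVec, dotProduct_sub, dotProduct_add,
          dotProduct_smul, smul_eq_mul, Complex.sub_re, Complex.add_re, Complex.re_ofReal_mul,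
          hq hx₀, hnv]
        rw [show (1 / 2 : ℂ) = ((1 / 2 : ℝ) : ℂ) by norm_num]
        simp only [Complex.re_ofReal_mul, hq hx₁, hq hx₂]
        linarith
    have hfin := half_det_rpow_add_le hn (hpsd hx₁) (hpsd hx₂) hc0 hdiff
    rw [det_pullbackHessian_rpow hx₁ hw' (hdet _ (hT hx₁ hw)) (hf _ (hT hx₁ hw)),
      det_pullbackHessian_rpow hx₂ hw' (hdet _ (hT hx₂ hw)) (hf _ (hT hx₂ hw)),
      det_pullbackHessian_rpow hx₀ hw' (hdet _ (hT hx₀ hw)) (hf _ (hT hx₀ hw))] at hfin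
    have := hg w hw
    linarith

lemma nonneg_of_holder_fderiv (hn : 0 < n) {f : EuclideanSpace ℂ (Fin n) → ℝ} {K α : ℝ}
    (hK : ∀ p ∈ ball (0 : EuclideanSpace ℂ (Fin n)) 1,
      ∀ q ∈ ball (0 : EuclideanSpace ℂ (Fin n)) 1,
        ‖fderiv ℝ f p - fderiv ℝ f q‖ ≤ K * ‖p - q‖ ^ α) : 0 ≤ K := by
  set e : EuclideanSpace ℂ (Fin n) := EuclideanSpace.single ⟨0, hn⟩ (1 / 2 : ℂ) with he
  have hne : ‖e‖ = 1 / 2 := by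
    rw [he, EuclideanSpace.single, PiLp.norm_single]
    norm_num
  have h := (norm_nonneg _).trans (hK e (mem_ball_zero_iff.2 (by rw [hne]; norm_num)) 0
    (mem_ball_self one_pos))
  rw [sub_zero, hne] at h
  exact nonneg_of_mul_nonneg_left h (by positivity)

lemma exists_solution_second_difference_le (hn : 0 < n) {r : ℝ} (hr : r < 1) :
    ∃ C, 0 ≤ C ∧ ∀ α : ℝ, 0 < α → α ≤ 1 →
      ∀ u f g Φ : EuclideanSpace ℂ (Fin n) → ℝ,
      ContDiffOn ℝ 2 u (ball 0 1) → ContinuousOn u (closedBall 0 1) →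
      (∀ z ∈ ball (0 : EuclideanSpace ℂ (Fin n)) 1, (cxHessian n u z).PosSemidef) →
      (∀ z ∈ ball (0 : EuclideanSpace ℂ (Fin n)) 1, (cxHessian n u z).det = (f z : ℂ)) →
      (∀ z ∈ ball (0 : EuclideanSpace ℂ (Fin n)) 1, 0 ≤ f z) →
      (∀ z ∈ ball (0 : EuclideanSpace ℂ (Fin n)) 1, g z = f z ^ ((n : ℝ)⁻¹)) →
      (∀ z ∈ ball (0 : EuclideanSpace ℂ (Fin n)) 1, DifferentiableAt ℝ g z) →
      ContinuousOn Φ (closedBall 0 1) →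
      (∀ z ∈ ball (0 : EuclideanSpace ℂ (Fin n)) 1, DifferentiableAt ℝ Φ z) →
      (∀ z ∈ sphere (0 : EuclideanSpace ℂ (Fin n)) 1, u z = Φ z) →
      ∀ KΦ K₀ K₁ K₂ : ℝ,
      (∀ p ∈ ball (0 : EuclideanSpace ℂ (Fin n)) 1,
        ∀ q ∈ ball (0 : EuclideanSpace ℂ (Fin n)) 1,
          ‖fderiv ℝ Φ p - fderiv ℝ Φ q‖ ≤ KΦ * ‖p - q‖ ^ α) →
      (∀ p ∈ ball (0 : EuclideanSpace ℂ (Fin n)) 1, |g p| ≤ K₀) →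
      (∀ p ∈ ball (0 : EuclideanSpace ℂ (Fin n)) 1, ‖fderiv ℝ g p‖ ≤ K₁) →
      (∀ p ∈ ball (0 : EuclideanSpace ℂ (Fin n)) 1,
        ∀ q ∈ ball (0 : EuclideanSpace ℂ (Fin n)) 1,
          ‖fderiv ℝ g p - fderiv ℝ g q‖ ≤ K₂ * ‖p - q‖ ^ α) →
      ∀ x y : EuclideanSpace ℂ (Fin n), ‖x‖ + ‖y‖ ≤ r →
        u (x + y) + u (x - y) - 2 * u x ≤ C * (KΦ + (K₀ + K₁ + K₂)) * ‖y‖ ^ (1 + α) := by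
  obtain ⟨C₁, hC₁, h₁⟩ := exists_second_difference_comp_ballAut_le n hr
  obtain ⟨C₂, hC₂, h₂⟩ := exists_second_difference_ballAutJac_mul_le n hr
  refine ⟨2 * C₁ + C₂, by positivity, fun α hα0 hα u f g Φ hu huc hpsh hdet hf hgf hgd hΦc hΦd hb
    KΦ K₀ K₁ K₂ hKΦ hK₀ hK₁ hK₂ x y hxy => ?_⟩
  have h0 : (0 : EuclideanSpace ℂ (Fin n)) ∈ ball 0 1 := mem_ball_self one_pos
  have nΦ := nonneg_of_holder_fderiv hn hKΦ
  have n0 : 0 ≤ K₀ := (abs_nonneg _).trans (hK₀ 0 h0)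
  have n1 : 0 ≤ K₁ := (norm_nonneg _).trans (hK₁ 0 h0)
  have n2 := nonneg_of_holder_fderiv hn hK₂
  have hx₁ : ‖x + y‖ < 1 := (norm_add_le x y).trans_lt (hxy.trans_lt hr)
  have hx₂ : ‖x - y‖ < 1 := (norm_sub_le x y).trans_lt (hxy.trans_lt hr)
  have hx₀ : ‖x‖ < 1 := by linarith [norm_nonneg y]
  set l : EuclideanSpace ℂ (Fin n) →L[ℝ] ℝ := -fderiv ℝ Φ 0 with hl
  have hld : ∀ p ∈ ball (0 : EuclideanSpace ℂ (Fin n)) 1,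
      fderiv ℝ (fun z => Φ z + l z) p = fderiv ℝ Φ p + l := fun p hp =>
    ((hΦd p hp).hasFDerivAt.add l.hasFDerivAt).fderiv
  have hT : ∀ {a w : EuclideanSpace ℂ (Fin n)}, ‖a‖ < 1 → w ∈ ball 0 1 →
      ballAut a w ∈ ball (0 : EuclideanSpace ℂ (Fin n)) 1 := fun ha hw =>
    mem_ball_zero_iff.2 (norm_ballAut_lt_one ha (mem_ball_zero_iff.1 hw))
  have hsecond := h₁ α hα0 hα (fun z => Φ z + l z) KΦ KΦ nΦ nΦ
    (fun p hp => (hΦd p hp).add l.differentiableAt)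
    (fun p hp q hq => by
      rw [hld p hp, hld q hq, add_sub_add_right_eq_sub]
      exact hKΦ p hp q hq)
    (fun p hp => by
      rw [hld p hp, hl, ← sub_eq_add_neg]
      refine (hKΦ p hp 0 h0).trans (mul_le_of_le_one_right nΦ ?_)
      rw [sub_zero]
      exact Real.rpow_le_one (norm_nonneg p) (mem_ball_zero_iff.1 hp).le hα0.le) x y
  have hcont : ∀ {a : EuclideanSpace ℂ (Fin n)}, ‖a‖ < 1 →
      ContinuousOn (fun w => Φ (ballAut a w) + l (ballAut a w)) (closedBall 0 1) := fun ha =>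
    (hΦc.add l.continuous.continuousOn).comp
      (fun w hw => (contDiffAt_ballAut (one_add_inner_ne_zero ha
        (mem_closedBall_zero_iff.1 hw))).continuousAt.continuousWithinAt)
      (fun w hw => mem_closedBall_zero_iff.2 (norm_ballAut_le_one ha (mem_closedBall_zero_iff.1 hw)))
  have hclosure : ∀ w ∈ closedBall (0 : EuclideanSpace ℂ (Fin n)) 1,
      (Φ (ballAut (x + y) w) + l (ballAut (x + y) w)) +
        (Φ (ballAut (x - y) w) + l (ballAut (x - y) w)) -
        2 * (Φ (ballAut x w) + l (ballAut x w)) ≤ C₁ * (KΦ + KΦ) * ‖y‖ ^ (1 + α) := by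
    intro w hw
    rw [← closure_ball (0 : EuclideanSpace ℂ (Fin n)) one_ne_zero] at hw
    refine le_on_closure (s := ball 0 1)
      (fun w hw => (le_abs_self _).trans (hsecond w hxy (mem_ball_zero_iff.1 hw))) ?_
      continuousOn_const hw
    rw [closure_ball _ one_ne_zero]
    exact ((hcont hx₁).add (hcont hx₂)).sub (continuousOn_const.mul (hcont hx₀))
  have hfinal := second_difference_le_of_boundary_le hn hu huc hpsh hdet hf l
    (hxy.trans_lt hr) (M := C₁ * (KΦ + KΦ) * ‖y‖ ^ (1 + α))
    (D := C₂ * (K₀ + K₁ + K₂) * ‖y‖ ^ (1 + α)) (by positivity) ?_ ?_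
  · refine hfinal.trans ?_
    have e1 : 0 ≤ (2 * C₁ * (K₀ + K₁ + K₂) + C₂ * KΦ) * ‖y‖ ^ (1 + α) := by positivity
    linarith
  · intro w hw
    have hs : ∀ {a : EuclideanSpace ℂ (Fin n)}, ‖a‖ < 1 →
        u (ballAut a w) = Φ (ballAut a w) := fun ha =>
      hb _ (mem_sphere_zero_iff_norm.2 (norm_ballAut_eq_one ha (mem_sphere_zero_iff_norm.1 hw)))
    rw [hs hx₁, hs hx₂, hs hx₀]
    exact hclosure w (sphere_subset_closedBall hw)
  · intro w hw
    rw [← hgf _ (hT hx₁ hw), ← hgf _ (hT hx₂ hw), ← hgf _ (hT hx₀ hw)]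
    exact (abs_le.1 (h₂ α hα0 hα g K₀ K₁ K₂ n0 n1 n2 hgd hK₀ hK₁ hK₂ x y w hxy
      (mem_ball_zero_iff.1 hw))).1

end PointwiseUpperBound

section SubMeanValue

variable {n : ℕ}

lemma sum_range_add_of_periodic {N : ℕ} {F : ℕ → ℝ} (hF : ∀ k, F (k + N) = F k) (j : ℕ) :
    ∑ k ∈ Finset.range N, F (j + k) = ∑ k ∈ Finset.range N, F k := by
  induction j with
  | zero => simp
  | succ j ih =>
    have h := (Finset.sum_range_succ (fun k => F (j + k)) N).symm.trans
      (Finset.sum_range_succ' (fun k => F (j + k)) N)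
    rw [hF, add_zero, add_left_inj, ih] at h
    rw [h]
    exact Finset.sum_congr rfl fun k _ => by rw [add_assoc, add_comm 1 k]

/-- The unimodular number `exp (2πi k / N)`. -/
noncomputable def unitRoot (N k : ℕ) : ℂ := Complex.exp (2 * Real.pi * (k / N) * Complex.I)

lemma norm_unitRoot (N k : ℕ) : ‖unitRoot N k‖ = 1 := by
  have h := Complex.norm_exp_ofReal_mul_I (2 * Real.pi * (k / N))
  push_cast at h
  exact h

lemma unitRoot_mul (N j k : ℕ) : unitRoot N j * unitRoot N k = unitRoot N (j + k) := by
  rw [unitRoot, unitRoot, unitRoot, ← Complex.exp_add]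
  congr 1
  push_cast
  ring

lemma unitRoot_add_self {N : ℕ} (hN : 0 < N) (k : ℕ) : unitRoot N (k + N) = unitRoot N k := by
  rw [← unitRoot_mul]
  have hN' : (N : ℂ) ≠ 0 := by exact_mod_cast hN.ne'
  rw [unitRoot, unitRoot, div_self hN', mul_one, Complex.exp_two_pi_mul_I, mul_one]

lemma exists_norm_sub_unitRoot_le {N : ℕ} (hN : 0 < N) {c : ℂ} (hc : ‖c‖ = 1) :
    ∃ j, ‖c - unitRoot N j‖ ≤ 2 * Real.pi / N := by
  have hN' : (0 : ℝ) < N := by exact_mod_cast hN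
  obtain ⟨θ, hθ, hcθ⟩ : ∃ θ : ℝ, 0 ≤ θ ∧ c = Complex.exp (θ * Complex.I) := by
    refine ⟨Complex.arg c + 2 * Real.pi, by linarith [Complex.neg_pi_lt_arg c, Real.pi_pos], ?_⟩
    have h := Complex.norm_mul_exp_arg_mul_I c
    rw [hc, Complex.ofReal_one, one_mul] at h
    push_cast
    rw [add_mul, Complex.exp_add, Complex.exp_two_pi_mul_I, mul_one, h]
  set j := ⌊θ * N / (2 * Real.pi)⌋₊ with hj
  have hj1 := Nat.floor_le (by positivity : 0 ≤ θ * N / (2 * Real.pi))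
  have hj2 := Nat.lt_floor_add_one (θ * N / (2 * Real.pi))
  rw [← hj] at hj1 hj2
  rw [le_div_iff₀ (by positivity)] at hj1
  rw [div_lt_iff₀ (by positivity)] at hj2
  refine ⟨j, ?_⟩
  have e : c - unitRoot N j = unitRoot N j *
      (Complex.exp (Complex.I * ((θ - 2 * Real.pi * (j / N) : ℝ) : ℂ)) - 1) := by
    rw [mul_sub, mul_one, hcθ, unitRoot, ← Complex.exp_add]
    congr 2
    push_cast
    ring
  rw [e, norm_mul, norm_unitRoot, one_mul]
  refine (Real.norm_exp_I_mul_ofReal_sub_one_le).trans ?_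
  rw [Real.norm_eq_abs, abs_le]
  have e2 : 2 * Real.pi * (j / N) = j * (2 * Real.pi) / N := by ring
  have h1 : j * (2 * Real.pi) / N ≤ θ := by rwa [div_le_iff₀ hN']
  have h2 : θ ≤ j * (2 * Real.pi) / N + 2 * Real.pi / N := by
    rw [← add_div, le_div_iff₀ hN']
    linarith
  rw [e2]
  constructor <;> [skip; linarith]
  have : 0 ≤ 2 * Real.pi / N := by positivity
  linarith

lemma exists_le_average_unitRoot {u : EuclideanSpace ℂ (Fin n) → ℝ}
    (hu : ContDiffOn ℝ 2 u (ball 0 1))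
    (hpsh : ∀ z ∈ ball (0 : EuclideanSpace ℂ (Fin n)) 1, (cxHessian n u z).PosSemidef)
    {x : EuclideanSpace ℂ (Fin n)} {h : ℝ} (hh : 0 < h) (hxh : ‖x‖ + h < 1) {ε : ℝ} (hε : 0 < ε) :
    ∃ N : ℕ, 0 < N ∧ ∀ y ∈ sphere (0 : EuclideanSpace ℂ (Fin n)) h,
      N * (u x - ε) ≤ ∑ k ∈ Finset.range N, u (x + unitRoot N k • y) := by
  have hball : closedBall x h ⊆ ball 0 1 := fun p hp => by
    rw [mem_ball_zero_iff]
    have := norm_le_norm_add_norm_sub' p x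
    rw [mem_closedBall, dist_eq_norm] at hp
    linarith
  have huc : UniformContinuousOn u (closedBall x h) :=
    (isCompact_closedBall x h).uniformContinuousOn_of_continuous (hu.continuousOn.mono hball)
  obtain ⟨δ, hδ, hδu⟩ := Metric.uniformContinuousOn_iff.1 huc (ε / 2) (by positivity)
  obtain ⟨N, hN⟩ := exists_nat_gt (max 1 (2 * Real.pi * h / δ))
  have hN1 : (1 : ℝ) < N := (le_max_left _ _).trans_lt hN
  have hN0 : (0 : ℝ) < N := by linarith
  have hNδ : 2 * Real.pi / N * h < δ := by
    have := (le_max_right _ _).trans_lt hN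
    rw [div_lt_iff₀ hδ] at this
    rw [div_mul_eq_mul_div, div_lt_iff₀ hN0]
    linarith
  have hNpos : 0 < N := by exact_mod_cast hN0
  refine ⟨N, hNpos, fun y hy => ?_⟩
  rw [mem_sphere_zero_iff_norm] at hy
  set T : ℕ → ℂ → EuclideanSpace ℂ (Fin n) := fun k c => x + (c * unitRoot N k) • y with hT
  have hTmem : ∀ k c, ‖c‖ ≤ 1 → T k c ∈ closedBall x h := fun k c hc => by
    rw [mem_closedBall, dist_eq_norm, hT]
    simp only [add_sub_cancel_left, norm_smul, norm_mul, norm_unitRoot, hy]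
    nlinarith
  have hTd : ∀ k, ContDiff ℂ 2 (T k) := fun k =>
    contDiff_const.add ((contDiff_id.mul contDiff_const).smul contDiff_const)
  have hud : ∀ k c, ‖c‖ ≤ 1 → ContDiffAt ℝ 2 u (T k c) := fun k c hc =>
    hu.contDiffAt (isOpen_ball.mem_nhds (hball (hTmem k c hc)))
  have huT : ∀ k c, ‖c‖ ≤ 1 → ContDiffAt ℝ 2 (fun c => u (T k c)) c := fun k c hc =>
    (hud k c hc).comp c ((hTd k).contDiffAt.restrict_scalars ℝ)
  have hlevi : ∀ k c, ‖c‖ ≤ 1 → 0 ≤ leviForm (fun c => u (T k c)) c 1 := by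
    intro k c hc
    rw [leviForm_comp (hud k c hc) (hTd k).contDiffAt]
    have h1 := re_dotProduct_cxHessian_mulVec (hud k c hc) (fderiv ℂ (T k) c 1)
    have h2 := (hpsh _ (hball (hTmem k c hc))).re_dotProduct_nonneg
      (star (fderiv ℂ (T k) c 1).ofLp)
    rw [star_star] at h2
    have h3 : 0 ≤ leviForm u (T k c) (fderiv ℂ (T k) c 1) / 4 := h1 ▸ h2
    linarith
  have hsum : ∀ (s : Finset ℕ) (c : ℂ), ‖c‖ ≤ 1 →
      ContDiffAt ℝ 2 (fun c => ∑ k ∈ s, u (T k c)) c ∧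
        0 ≤ leviForm (fun c => ∑ k ∈ s, u (T k c)) c 1 := by
    intro s c hc
    induction s using Finset.induction_on with
    | empty =>
      refine ⟨by simpa using contDiffAt_const, ?_⟩
      have := leviForm_clm (0 : ℂ →L[ℝ] ℝ) c 1
      simp only [Finset.sum_empty]
      exact this.ge
    | insert a s ha ih =>
      simp only [Finset.sum_insert ha]
      refine ⟨(huT a c hc).add ih.1, ?_⟩
      rw [leviForm_add (huT a c hc) ih.1]
      exact add_nonneg (hlevi a c hc) ih.2
  have hnorm : ContDiff ℝ 2 (fun c : ℂ => ‖c‖ ^ 2) := contDiff_norm_sq ℝ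
  have key := le_of_exists_fderiv_fderiv_pos
    (W := fun c : ℂ => ∑ k ∈ Finset.range N, u (T k c) + ε / 2 * ‖c‖ ^ 2)
    (M := ∑ k ∈ Finset.range N, u (x + unitRoot N k • y) + N * (ε / 2) + ε / 2) ?_ ?_ ?_ ?_
  · simp only [hT, zero_mul, zero_smul, add_zero, Finset.sum_const, Finset.card_range,
      nsmul_eq_mul, norm_zero] at key
    nlinarith
  · intro c hc
    exact (((hsum _ c (mem_closedBall_zero_iff.1 hc)).1).add
      (contDiffAt_const.mul hnorm.contDiffAt)).continuousAt.continuousWithinAt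
  · intro c hc
    exact ((hsum _ c (mem_ball_zero_iff.1 hc).le).1).add (contDiffAt_const.mul hnorm.contDiffAt)
  · intro c hc
    rw [mem_sphere_zero_iff_norm] at hc
    obtain ⟨j, hj⟩ := exists_norm_sub_unitRoot_le hNpos hc
    have hclose : ∀ k, u (T k c) ≤ u (x + unitRoot N (j + k) • y) + ε / 2 := by
      intro k
      have hd : dist (T k c) (T k (unitRoot N j)) < δ := by
        rw [dist_eq_norm]
        simp only [hT]
        rw [add_sub_add_left_eq_sub, ← sub_smul, ← sub_mul, norm_smul, norm_mul, norm_unitRoot,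
          mul_one, hy]
        exact (mul_le_mul_of_nonneg_right hj hh.le).trans_lt hNδ
      have := hδu _ (hTmem k c hc.le) _ (hTmem k _ (norm_unitRoot N j).le) hd
      rw [Real.dist_eq] at this
      simp only [hT, unitRoot_mul] at this ⊢
      linarith [(abs_lt.1 this).2]
    have h1 := Finset.sum_le_sum fun k (_ : k ∈ Finset.range N) => hclose k
    rw [Finset.sum_add_distrib, Finset.sum_const, Finset.card_range, nsmul_eq_mul,
      sum_range_add_of_periodic (F := fun k => u (x + unitRoot N k • y))
        (fun k => by rw [unitRoot_add_self hNpos])] at h1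
    rw [hc]
    linarith
  · intro c hc
    have hc' := (mem_ball_zero_iff.1 hc).le
    refine exists_fderiv_fderiv_pos_of_leviForm_pos (v := 1) ?_
    rw [leviForm_add (hsum _ c hc').1 (contDiffAt_const.mul hnorm.contDiffAt),
      leviForm_const_mul hnorm.contDiffAt, leviForm_norm_sq]
    have := (hsum (Finset.range N) c hc').2
    rw [norm_one]
    linarith

end SubMeanValue

section SphereAverage

variable {E : Type*} [NormedAddCommGroup E] [MeasurableSpace E] [BorelSpace E]

lemma integrableOn_sphere [ProperSpace E] {F : E → ℝ} {h d : ℝ} (hF : ContinuousOn F (sphere 0 h))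
    (hfin : μH[d] (sphere (0 : E) h) < ⊤) : IntegrableOn F (sphere 0 h) μH[d] := by
  obtain ⟨C, hC⟩ := (isCompact_sphere (0 : E) h).exists_bound_of_continuousOn hF
  exact ⟨hF.aestronglyMeasurable isClosed_sphere.measurableSet, .restrict_of_bounded (C := C) hfin
    (ae_restrict_of_forall_mem isClosed_sphere.measurableSet hC)⟩

variable [NormedSpace ℂ E]

/-- Multiplication by a unimodular complex number, as an isometry. -/
noncomputable def unimodularSMul (c : ℂ) (hc : ‖c‖ = 1) : E ≃ᵢ E where
  toFun y := c • y
  invFun y := c⁻¹ • y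
  left_inv y := inv_smul_smul₀ (norm_ne_zero_iff.1 (hc ▸ one_ne_zero)) y
  right_inv y := smul_inv_smul₀ (norm_ne_zero_iff.1 (hc ▸ one_ne_zero)) y
  isometry_toFun := Isometry.of_dist_eq fun x y => by
    rw [dist_eq_norm, dist_eq_norm, ← smul_sub, norm_smul, hc, one_mul]

lemma setIntegral_sphere_unimodular_smul (F : E → ℝ) {c : ℂ} (hc : ‖c‖ = 1) (h d : ℝ) :
    ∫ y in sphere (0 : E) h, F (c • y) ∂μH[d] = ∫ y in sphere (0 : E) h, F y ∂μH[d] := by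
  have hpre : (unimodularSMul c hc : E → E) ⁻¹' sphere 0 h = sphere 0 h := by
    ext y
    simp [unimodularSMul, norm_smul, hc]
  have key := ((unimodularSMul (E := E) c hc).measurePreserving_hausdorffMeasure
    d).setIntegral_preimage_emb
    (unimodularSMul c hc).toHomeomorph.measurableEmbedding F (sphere 0 h)
  rwa [hpre] at key

lemma le_setAverage_sphere_of_le_sum [ProperSpace E] {F : E → ℝ} {h d A : ℝ}
    (hF : ContinuousOn F (sphere 0 h)) (hpos : 0 < μH[d] (sphere (0 : E) h))
    (hfin : μH[d] (sphere (0 : E) h) < ⊤) {N : ℕ} (hN : 0 < N) {c : ℕ → ℂ} (hc : ∀ k, ‖c k‖ = 1)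
    (hA : ∀ y ∈ sphere (0 : E) h, N * A ≤ ∑ k ∈ Finset.range N, F (c k • y)) :
    A ≤ ⨍ y in sphere (0 : E) h, F y ∂μH[d] := by
  have hμ : 0 < (μH[d] : Measure E).real (sphere 0 h) := ENNReal.toReal_pos hpos.ne' hfin.ne
  have hFi : ∀ k, IntegrableOn (fun y => F (c k • y)) (sphere 0 h) μH[d] := fun k =>
    integrableOn_sphere (hF.comp (continuous_const_smul (c k)).continuousOn fun y hy => by
      rw [mem_sphere_zero_iff_norm] at hy ⊢
      rw [norm_smul, hc, one_mul, hy]) hfin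
  have h1 := setIntegral_mono_on (integrableOn_const hfin.ne)
    (integrable_finsetSum (Finset.range N) fun k _ => hFi k) isClosed_sphere.measurableSet hA
  rw [integral_finsetSum _ fun k _ => hFi k, setIntegral_const] at h1
  simp only [setIntegral_sphere_unimodular_smul F (hc _), Finset.sum_const, Finset.card_range,
    nsmul_eq_mul, smul_eq_mul] at h1
  rw [setAverage_eq, smul_eq_mul, inv_mul_eq_div, le_div_iff₀ hμ]
  have hN' : (0 : ℝ) < N := by exact_mod_cast hN
  refine le_of_mul_le_mul_left ?_ hN'
  linarith

lemma setAverage_sphere_le_of_add_le [ProperSpace E] {F : E → ℝ} {h d A : ℝ}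
    (hF : ContinuousOn F (sphere 0 h)) (hpos : 0 < μH[d] (sphere (0 : E) h))
    (hfin : μH[d] (sphere (0 : E) h) < ⊤)
    (hA : ∀ y ∈ sphere (0 : E) h, F y + F (-y) ≤ 2 * A) :
    ⨍ y in sphere (0 : E) h, F y ∂μH[d] ≤ A := by
  have hsum : ∀ y ∈ sphere (0 : E) h, ((2 : ℕ) : ℝ) * (-A) ≤
      ∑ k ∈ Finset.range 2, -F ((-1 : ℂ) ^ k • y) := fun y hy => by
    have := hA y hy
    simp only [Finset.sum_range_succ, Finset.sum_range_zero, pow_zero, pow_one, one_smul, neg_smul]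
    push_cast
    linarith
  have key := le_setAverage_sphere_of_le_sum hF.neg hpos hfin two_pos (fun k => by simp) hsum
  rw [setAverage_eq, integral_neg', smul_neg, ← setAverage_eq] at key
  linarith

end SphereAverage

section MeanValueInequality

variable {n : ℕ}

lemma finrank_real_euclideanSpace_complex :
    Module.finrank ℝ (EuclideanSpace ℂ (Fin n)) = 2 * n := by
  rw [← Module.finrank_mul_finrank ℝ ℂ (EuclideanSpace ℂ (Fin n)), Complex.finrank_real_complex,
    finrank_euclideanSpace_fin]

lemma continuousOn_comp_const_add {u : EuclideanSpace ℂ (Fin n) → ℝ}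
    (hu : ContinuousOn u (ball 0 1)) {x : EuclideanSpace ℂ (Fin n)} {h : ℝ} (hxh : ‖x‖ + h < 1) :
    ContinuousOn (fun y => u (x + y)) (sphere 0 h) :=
  hu.comp (continuous_const_add x).continuousOn fun y hy => by
    rw [mem_sphere_zero_iff_norm] at hy
    rw [mem_ball_zero_iff]
    exact (norm_add_le x y).trans_lt (hy.symm ▸ hxh)

lemma le_sphereAvgC (hn : 0 < n) {u : EuclideanSpace ℂ (Fin n) → ℝ}
    (hu : ContDiffOn ℝ 2 u (ball 0 1))
    (hpsh : ∀ z ∈ ball (0 : EuclideanSpace ℂ (Fin n)) 1, (cxHessian n u z).PosSemidef)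
    {x : EuclideanSpace ℂ (Fin n)} {h : ℝ} (hh : 0 < h) (hxh : ‖x‖ + h < 1) :
    u x ≤ sphereAvgC n u x h := by
  let : MeasurableSpace (EuclideanSpace ℂ (Fin n)) := borel _
  have : BorelSpace (EuclideanSpace ℂ (Fin n)) := ⟨rfl⟩
  have : Nonempty (Fin n) := ⟨⟨0, hn⟩⟩
  have hpos := hausdorffMeasure_sphere_pos (E := EuclideanSpace ℂ (Fin n)) hh
  have hfin := hausdorffMeasure_sphere_lt_top (E := EuclideanSpace ℂ (Fin n)) hh
  rw [finrank_real_euclideanSpace_complex, Nat.cast_mul, Nat.cast_two] at hpos hfin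
  refine le_of_forall_pos_sub_le fun ε hε => ?_
  obtain ⟨N, hN, hsum⟩ := exists_le_average_unitRoot hu hpsh hh hxh hε
  exact le_setAverage_sphere_of_le_sum (continuousOn_comp_const_add hu.continuousOn hxh) hpos hfin
    hN (norm_unitRoot N) hsum

lemma sphereAvgC_le_of_add_le (hn : 0 < n) {u : EuclideanSpace ℂ (Fin n) → ℝ}
    (hu : ContinuousOn u (ball 0 1)) {x : EuclideanSpace ℂ (Fin n)} {h A : ℝ} (hh : 0 < h)
    (hxh : ‖x‖ + h < 1) (hA : ∀ y, ‖y‖ = h → u (x + y) + u (x - y) ≤ 2 * A) :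
    sphereAvgC n u x h ≤ A := by
  let : MeasurableSpace (EuclideanSpace ℂ (Fin n)) := borel _
  have : BorelSpace (EuclideanSpace ℂ (Fin n)) := ⟨rfl⟩
  have : Nonempty (Fin n) := ⟨⟨0, hn⟩⟩
  have hpos := hausdorffMeasure_sphere_pos (E := EuclideanSpace ℂ (Fin n)) hh
  have hfin := hausdorffMeasure_sphere_lt_top (E := EuclideanSpace ℂ (Fin n)) hh
  rw [finrank_real_euclideanSpace_complex, Nat.cast_mul, Nat.cast_two] at hpos hfin
  refine setAverage_sphere_le_of_add_le (continuousOn_comp_const_add hu hxh) hpos hfin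
    fun y hy => ?_
  rw [← sub_eq_add_neg]
  exact hA y (mem_sphere_zero_iff_norm.1 hy)

end MeanValueInequality

/-- **Mean value inequality for the solution** (inequality (3.52)). If
`u ∈ PSH(B) ∩ C(B̄)` solves `det(u_{i j̄}) = f` in the unit ball `B ⊂ ℂⁿ` with
`u = φ` on `∂B`, `φ ∈ C^{1,α}(∂B)`, `f ≥ 0`, `f^{1/n} ∈ C^{1,α}(B̄)`, `α ∈ (0,1]`,
then for every `t ∈ (0,1]` there is `C = C(n,t)` such that for every `x` with
`|x| < 1 - t/2` and every `h ∈ (0, t/4)`: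
`0 ≤ ⨍_{∂B_h(0)} u(x+y) dσ_y - u(x) ≤ C ([φ]_{1,α;∂B} + |f^{1/n}|'_{1,α;B}) h^{1+α}`.
The boundary seminorm (an infimum over extensions) is expressed by quantifying over
all extensions `Φ ∈ C^{1,α}(B̄)` with Hölder gradient constant `KΦ`, and
`|f^{1/n}|'_{1,α;B}` through upper bounds `K₀, K₁, K₂` of its three pieces. -/
theorem mean_value_inequality_solution (n : ℕ) (hn : 0 < n)
    (t : ℝ) (ht0 : 0 < t) (ht1 : t ≤ 1) :
    ∃ C : ℝ, ∀ (α : ℝ), 0 < α → α ≤ 1 →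
      ∀ u f g Φ : EuclideanSpace ℂ (Fin n) → ℝ,
      -- u ∈ C²(B) ∩ C(B̄)
      ContDiffOn ℝ 2 u (ball 0 1) →
      ContinuousOn u (closedBall 0 1) →
      -- u is plurisubharmonic on B
      (∀ z ∈ ball (0 : EuclideanSpace ℂ (Fin n)) 1, (cxHessian n u z).PosSemidef) →
      -- the complex Monge-Ampère equation det(u_{i j̄}) = f in B
      (∀ z ∈ ball (0 : EuclideanSpace ℂ (Fin n)) 1, (cxHessian n u z).det = (f z : ℂ)) →
      -- f ≥ 0 and g = f^{1/n}
      (∀ z ∈ closedBall (0 : EuclideanSpace ℂ (Fin n)) 1, 0 ≤ f z) →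
      (∀ z ∈ closedBall (0 : EuclideanSpace ℂ (Fin n)) 1, g z = f z ^ ((n : ℝ)⁻¹)) →
      -- g = f^{1/n} ∈ C^{1,α}(B̄)
      ContinuousOn g (closedBall 0 1) →
      DifferentiableOn ℝ g (ball 0 1) →
      -- Φ ∈ C^{1,α}(B̄) is an extension of the boundary datum φ, and u = φ on ∂B
      ContinuousOn Φ (closedBall 0 1) →
      DifferentiableOn ℝ Φ (ball 0 1) →
      (∀ z ∈ sphere (0 : EuclideanSpace ℂ (Fin n)) 1, u z = Φ z) →
      ∀ KΦ K₀ K₁ K₂ : ℝ,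
      (∀ x ∈ ball (0 : EuclideanSpace ℂ (Fin n)) 1,
        ∀ y ∈ ball (0 : EuclideanSpace ℂ (Fin n)) 1,
          ‖fderiv ℝ Φ x - fderiv ℝ Φ y‖ ≤ KΦ * ‖x - y‖ ^ α) →
      (∀ x ∈ ball (0 : EuclideanSpace ℂ (Fin n)) 1, |g x| ≤ K₀) →
      (∀ x ∈ ball (0 : EuclideanSpace ℂ (Fin n)) 1, ‖fderiv ℝ g x‖ ≤ K₁) →
      (∀ x ∈ ball (0 : EuclideanSpace ℂ (Fin n)) 1,
        ∀ y ∈ ball (0 : EuclideanSpace ℂ (Fin n)) 1,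
          ‖fderiv ℝ g x - fderiv ℝ g y‖ ≤ K₂ * ‖x - y‖ ^ α) →
      -- conclusion
      ∀ x : EuclideanSpace ℂ (Fin n), ‖x‖ < 1 - t / 2 →
      ∀ h : ℝ, 0 < h → h < t / 4 →
        0 ≤ sphereAvgC n u x h - u x ∧
        sphereAvgC n u x h - u x ≤ C * (KΦ + (K₀ + K₁ + K₂)) * h ^ (1 + α) := by
  have hr : 1 - t / 4 < 1 := by linarith
  obtain ⟨C, hC, hbound⟩ := exists_solution_second_difference_le hn hr
  refine ⟨C / 2, fun α hα0 hα u f g Φ hu huc hpsh hdet hf hg _ hgd hΦc hΦd hb KΦ K₀ K₁ K₂ hKΦ hK₀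
    hK₁ hK₂ x hx h hh0 hh => ?_⟩
  have hxh : ‖x‖ + h < 1 := by linarith
  refine ⟨sub_nonneg.2 (le_sphereAvgC hn hu hpsh hh0 hxh), ?_⟩
  rw [sub_le_iff_le_add]
  refine sphereAvgC_le_of_add_le hn hu.continuousOn hh0 hxh fun y hy => ?_
  have key := hbound α hα0 hα u f g Φ hu huc hpsh hdet (fun z hz => hf z (ball_subset_closedBall hz))
    (fun z hz => hg z (ball_subset_closedBall hz))
    (fun z hz => hgd.differentiableAt (isOpen_ball.mem_nhds hz)) hΦc
    (fun z hz => hΦd.differentiableAt (isOpen_ball.mem_nhds hz)) hb KΦ K₀ K₁ K₂ hKΦ hK₀ hK₁ hK₂ x y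
    (by linarith)
  rw [hy] at key
  linarith
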